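/- (Claim 1) Let k > 0, let D ⊂ ℝ³ be a bounded open set containing the origin, and let K² : ℝ³ → ℂ be twice continuously differentiable with K²(x) ≠ 0 for all x, K²(x) = k² for x ∉ D, Im K²(x) ≥ 0 for all x, and ∇K² = 0 on the boundary of D. Set p := K² − k² and q := ∇K²/K². Let α ∈ ℝ³ with |α| = 1 and ℰ ∈ ℝ³ with ℰ·α = 0, and let E : ℝ³ → ℂ³ be twice continuously differentiable and satisfy the integral equation E(x) = ℰ e^{ikα·x} + ∫_D g(x,y) p(y) E(y) dy + ∇ₓ ∫_D g(x,y) q(y)·E(y) dy for all x ∈ ℝ³. Then curl(curl E)(x) = K²(x)·E(x) and div(K²·E)(x) = 0 for all x ∈ ℝ³. -/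

import Mathlib

/- STATEMENT 9 (Claim 1): Under the stated assumptions on K² and D, any C²
solution E of the integral equation
E(x) = ℰ e^{ikα·x} + ∫_D g(x,y) p(y) E(y) dy + ∇ₓ ∫_D g(x,y) q(y)·E(y) dy
satisfies curl(curl E) = K² E and div(K² E) = 0 on ℝ³. -/

noncomputable section

open Real Complex MeasureTheory

abbrev R3 : Type := EuclideanSpace ℝ (Fin 3)

/-- Partial derivative ∂ᵢ of a scalar function. -/
def pd (i : Fin 3) (f : R3 → ℂ) (x : R3) : ℂ :=
  fderiv ℝ f x (EuclideanSpace.single i (1 : ℝ))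

/-- Divergence of a vector field. -/
def vdiv (F : R3 → Fin 3 → ℂ) (x : R3) : ℂ := ∑ i, pd i (fun y => F y i) x

/-- Curl of a vector field. -/
def curl (F : R3 → Fin 3 → ℂ) (x : R3) : Fin 3 → ℂ :=
  ![pd 1 (fun y => F y 2) x - pd 2 (fun y => F y 1) x,
    pd 2 (fun y => F y 0) x - pd 0 (fun y => F y 2) x,
    pd 0 (fun y => F y 1) x - pd 1 (fun y => F y 0) x]

/-- Bilinear dot product of complex vectors (no conjugation). -/
def dotc (u v : Fin 3 → ℂ) : ℂ := ∑ i, u i * v i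

/-- Gradient of a scalar function. -/
def grad (f : R3 → ℂ) (x : R3) : Fin 3 → ℂ := fun i => pd i f x

/-- The weakly singular kernel g(x,y) = e^{ik|x−y|}/(4π|x−y|). -/
def g (k : ℝ) (x y : R3) : ℂ :=
  Complex.exp (Complex.I * (k : ℂ) * (‖x - y‖ : ℝ)) / (4 * (Real.pi : ℂ) * (‖x - y‖ : ℝ))

open scoped ContDiff Topology ComplexConjugate

section Calculus

variable {u v : R3 → ℂ} {x : R3}

lemma pd_add (i : Fin 3) (hu : DifferentiableAt ℝ u x) (hv : DifferentiableAt ℝ v x) :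
    pd i (fun y => u y + v y) x = pd i u x + pd i v x := by
  simp [pd, fderiv_fun_add hu hv]

lemma pd_sub (i : Fin 3) (hu : DifferentiableAt ℝ u x) (hv : DifferentiableAt ℝ v x) :
    pd i (fun y => u y - v y) x = pd i u x - pd i v x := by
  simp [pd, fderiv_fun_sub hu hv]

lemma pd_mul (i : Fin 3) (hu : DifferentiableAt ℝ u x) (hv : DifferentiableAt ℝ v x) :
    pd i (fun y => u y * v y) x = pd i u x * v x + u x * pd i v x := by
  simp only [pd, fderiv_fun_mul hu hv]
  simp
  ring

lemma pd_const_mul (i : Fin 3) (c : ℂ) (hu : DifferentiableAt ℝ u x) :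
    pd i (fun y => c * u y) x = c * pd i u x := by
  simp [pd, fderiv_const_mul hu]

lemma pd_const (i : Fin 3) (c : ℂ) : pd i (fun _ => c) x = 0 := by
  simp [pd]

lemma pd_sum {ι : Type*} (s : Finset ι) (i : Fin 3) {w : ι → R3 → ℂ}
    (hw : ∀ j ∈ s, DifferentiableAt ℝ (w j) x) :
    pd i (fun y => ∑ j ∈ s, w j y) x = ∑ j ∈ s, pd i (w j) x := by
  simp [pd, fderiv_fun_sum hw]

lemma pd_conj (i : Fin 3) (u : R3 → ℂ) (x : R3) :
    pd i (fun y => conj (u y)) x = conj (pd i u x) := by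
  have := (Complex.conjCLE : ℂ ≃L[ℝ] ℂ).comp_fderiv (f := u) (x := x)
  have h2 : (fun y => conj (u y)) = (Complex.conjCLE : ℂ ≃L[ℝ] ℂ) ∘ u := by
    ext y; simp
  rw [pd, h2, this]
  simp [pd]

lemma pd_congr {i : Fin 3} (h : u =ᶠ[𝓝 x] v) : pd i u x = pd i v x := by
  rw [pd, pd, h.fderiv_eq]

lemma pd_eventuallyEq {i : Fin 3} (h : u =ᶠ[𝓝 x] v) : pd i u =ᶠ[𝓝 x] pd i v :=
  h.fderiv.mono fun y hy => by rw [pd, pd, hy]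

lemma ContDiffAt.pd {n m : ℕ∞ω} (hu : ContDiffAt ℝ n u x) (h : m + 1 ≤ n) (i : Fin 3) :
    ContDiffAt ℝ m (pd i u) x :=
  (hu.fderiv_right h).clm_apply contDiffAt_const

lemma ContDiff.pd {n m : ℕ∞ω} (hu : ContDiff ℝ n u) (h : m + 1 ≤ n) (i : Fin 3) :
    ContDiff ℝ m (pd i u) :=
  (hu.fderiv_right h).clm_apply contDiff_const

lemma ContDiff.continuous_pd (hu : ContDiff ℝ 1 u) (i : Fin 3) : Continuous (_root_.pd i u) :=
  (hu.pd (m := 0) (by simp) i).continuous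

lemma HasCompactSupport.pd (hu : HasCompactSupport u) (i : Fin 3) :
    HasCompactSupport (pd i u) :=
  (hu.fderiv ℝ).comp_left (g := fun L : R3 →L[ℝ] ℂ => L (EuclideanSpace.single i 1)) rfl

lemma fderiv_fderiv_comm {V : Type*} [NormedAddCommGroup V] [NormedSpace ℝ V] {f : V → ℂ} {q : V}
    (hf : ContDiffAt ℝ 2 f q) (a b : V) :
    fderiv ℝ (fun p => fderiv ℝ f p a) q b = fderiv ℝ (fun p => fderiv ℝ f p b) q a := by
  have hd : DifferentiableAt ℝ (fderiv ℝ f) q :=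
    (hf.fderiv_right (m := 1) (by norm_num)).differentiableAt one_ne_zero
  have := hf.isSymmSndFDerivAt (by simp)
  rw [fderiv_clm_apply hd (differentiableAt_const a),
    fderiv_clm_apply hd (differentiableAt_const b)]
  simpa using this b a

lemma pd_comm (hu : ContDiffAt ℝ 2 u x) (i j : Fin 3) : pd i (pd j u) x = pd j (pd i u) x :=
  fderiv_fderiv_comm hu _ _

/-- The Laplacian of a scalar function. -/
def lap (f : R3 → ℂ) (x : R3) : ℂ := ∑ j, pd j (pd j f) x

lemma lap_congr (h : u =ᶠ[𝓝 x] v) : lap u x = lap v x :=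
  Finset.sum_congr rfl fun _ _ => pd_congr (pd_eventuallyEq h)

lemma hasCompactSupport_conj (hu : HasCompactSupport u) : HasCompactSupport (fun y => conj (u y)) :=
  hu.comp_left (g := fun z : ℂ => conj z) (map_zero _)

lemma contDiff_conj {n : ℕ∞ω} (hu : ContDiff ℝ n u) : ContDiff ℝ n (fun y => conj (u y)) :=
  (Complex.conjCLE : ℂ ≃L[ℝ] ℂ).contDiff.comp hu

lemma integral_pd_eq_zero (hu : ContDiff ℝ 1 u) (hc : HasCompactSupport u) (i : Fin 3) :
    ∫ y, pd i u y = 0 := by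
  have h := integral_mul_fderiv_eq_neg_fderiv_mul_of_integrable (μ := (volume : Measure R3))
    (f := fun _ => (1 : ℂ)) (g := u) (v := EuclideanSpace.single i (1 : ℝ))
    (by simp)
    (by simp only [one_mul]
        exact (hu.continuous_pd i).integrable_of_hasCompactSupport (hc.pd i))
    (by simpa using hu.continuous.integrable_of_hasCompactSupport hc)
    (fun _ _ => differentiableAt_const _)
    (fun y _ => hu.differentiable one_ne_zero y)
  simpa [pd] using h

lemma fderiv_eq_sum_pd (u : R3 → ℂ) (x w : R3) :
    fderiv ℝ u x w = ∑ j, (w j : ℂ) * pd j u x := by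
  have hw : w = ∑ j, w j • EuclideanSpace.single j (1 : ℝ) := by
    ext i
    simp [Finset.sum_apply, Pi.single_apply]
  conv_lhs => rw [hw]
  simp [map_sum, pd]

end Calculus

section Kernel

open Set Metric

/-- The outgoing fundamental solution of the Helmholtz operator. -/
def hker (k : ℝ) (z : R3) : ℂ :=
  Complex.exp (Complex.I * (k : ℂ) * (‖z‖ : ℝ)) / (4 * (Real.pi : ℂ) * (‖z‖ : ℝ))

/-- The radial factor of the gradient of `hker`: `∇ hker z = kerRad z • z`. -/
def kerRad (k : ℝ) (z : R3) : ℂ :=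
  Complex.exp (Complex.I * (k : ℂ) * (‖z‖ : ℝ)) * (Complex.I * (k : ℂ) * (‖z‖ : ℝ) - 1)
    / (4 * (Real.pi : ℂ) * (‖z‖ : ℝ) ^ 3)

lemma norm_exp_I_mul_mul (k r : ℝ) : ‖Complex.exp (Complex.I * (k : ℂ) * (r : ℂ))‖ = 1 := by
  rw [show Complex.I * (k : ℂ) * (r : ℂ) = ((k * r : ℝ) : ℂ) * Complex.I by push_cast; ring,
    Complex.norm_exp_ofReal_mul_I]

lemma measurable_ker (k : ℝ) : Measurable (hker k) := by
  unfold hker; fun_prop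

lemma measurable_kerRad (k : ℝ) : Measurable (kerRad k) := by
  unfold kerRad; fun_prop

lemma norm_ker (k : ℝ) (z : R3) : ‖hker k z‖ = (4 * π)⁻¹ * ‖z‖⁻¹ := by
  rw [hker, norm_div, norm_exp_I_mul_mul]
  simp [abs_of_pos Real.pi_pos]
  ring

lemma norm_kerRad_le (k : ℝ) (z : R3) :
    ‖kerRad k z‖ ≤ (4 * π)⁻¹ * (|k| * (‖z‖⁻¹) ^ 2 + (‖z‖⁻¹) ^ 3) := by
  rcases eq_or_ne z 0 with rfl | hz
  · simp [kerRad]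
  have hz' : 0 < ‖z‖ := norm_pos_iff.2 hz
  rw [kerRad, norm_div, norm_mul, norm_exp_I_mul_mul]
  have h1 : ‖Complex.I * (k : ℂ) * ((‖z‖ : ℝ) : ℂ) - 1‖ ≤ |k| * ‖z‖ + 1 := by
    refine (norm_sub_le _ _).trans ?_
    simp
  have h2 : ‖(4 * (π : ℂ) * ((‖z‖ : ℝ) : ℂ) ^ 3)‖ = 4 * π * ‖z‖ ^ 3 := by
    simp [abs_of_pos Real.pi_pos]
  rw [h2, one_mul, div_le_iff₀ (by positivity)]
  refine h1.trans (le_of_eq ?_)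
  have := Real.pi_pos
  field_simp

lemma locallyIntegrable_norm_inv_pow {n : ℕ} (hn : n ≤ 2) :
    LocallyIntegrable (fun z : R3 => (‖z‖⁻¹) ^ n) := by
  intro x
  refine ⟨ball 0 (‖x‖ + 1), isOpen_ball.mem_nhds (by simp), ?_⟩
  rw [integrableOn_fun_norm_addHaar volume (f := fun r : ℝ => (r⁻¹) ^ n)]
  have : IntegrableOn (fun y : ℝ => y ^ (2 - n)) (Ioo 0 (‖x‖ + 1)) :=
    ((continuous_pow _).integrableOn_Icc (a := 0) (b := ‖x‖ + 1)).mono_set Ioo_subset_Icc_self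
  refine this.congr_fun (fun y hy => ?_) measurableSet_Ioo
  have hy0 : y ≠ 0 := hy.1.ne'
  simp only [finrank_euclideanSpace, Fintype.card_fin, smul_eq_mul]
  interval_cases n <;> simp <;> field_simp

lemma locallyIntegrable_ker (k : ℝ) : LocallyIntegrable (hker k) := by
  refine ((locallyIntegrable_norm_inv_pow (n := 1) (by norm_num)).smul ((4 * π)⁻¹)).mono
    (measurable_ker k).aestronglyMeasurable (.of_forall fun z => ?_)
  have := Real.pi_pos
  rw [norm_ker]
  simp [abs_of_pos this]

/-- The directional derivative of `hker k` in the direction `v`. -/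
def kerD (k : ℝ) (v z : R3) : ℂ := kerRad k z * (inner ℝ z v : ℝ)

lemma measurable_kerD (k : ℝ) (v : R3) : Measurable (kerD k v) := by
  unfold kerD
  have := measurable_kerRad k
  fun_prop

lemma locallyIntegrable_kerD (k : ℝ) (v : R3) : LocallyIntegrable (kerD k v) := by
  refine (((((locallyIntegrable_norm_inv_pow (n := 1) (by norm_num)).smul |k|).add
    (locallyIntegrable_norm_inv_pow (n := 2) (by norm_num))).smul ((4 * π)⁻¹ * ‖v‖))).mono
    (measurable_kerD k v).aestronglyMeasurable (.of_forall fun z => ?_)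
  have := Real.pi_pos
  rcases eq_or_ne z 0 with rfl | hz
  · simp [kerD]
  have hz' : 0 < ‖z‖ := norm_pos_iff.2 hz
  have h1 : ‖((inner ℝ z v : ℝ) : ℂ)‖ ≤ ‖z‖ * ‖v‖ := by
    rw [Complex.norm_real]; exact norm_inner_le_norm z v
  rw [kerD, norm_mul]
  calc _ ≤ (4 * π)⁻¹ * (|k| * (‖z‖⁻¹) ^ 2 + (‖z‖⁻¹) ^ 3) * (‖z‖ * ‖v‖) := by
        gcongr
        exact norm_kerRad_le k z
    _ = (4 * π)⁻¹ * ‖v‖ * (|k| * ‖z‖⁻¹ ^ 1 + ‖z‖⁻¹ ^ 2) := by field_simp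
    _ ≤ _ := by
      simp only [Pi.smul_apply, Pi.add_apply, smul_eq_mul]
      exact le_abs_self _

lemma integral_eq_of_radial_integral {F : R3 → ℂ} (hF : Integrable F) {c : ℂ}
    (h : ∀ e : R3, ‖e‖ = 1 → ∫ r in Ioi (0 : ℝ), (r : ℂ) ^ 2 * F (r • e) = c) :
    ∫ z, F z = 4 * π * c := by
  have hmp := (volume : Measure R3).measurePreserving_homeomorphUnitSphereProd
  have hemb := (homeomorphUnitSphereProd R3).measurableEmbedding
  set G : sphere (0 : R3) 1 × Ioi (0 : ℝ) → ℂ := fun p => F (p.2.1 • p.1.1) with hG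
  have hcomp : ∀ x : ({(0 : R3)}ᶜ : Set R3), G (homeomorphUnitSphereProd R3 x) = F x := by
    intro x
    have := congrArg Subtype.val ((homeomorphUnitSphereProd R3).symm_apply_apply x)
    rw [homeomorphUnitSphereProd_symm_apply_coe] at this
    exact congrArg F this
  have hFc : Integrable (fun x : ({(0 : R3)}ᶜ : Set R3) => F x)
      ((volume : Measure R3).comap (↑)) :=
    (integrableOn_iff_comap_subtypeVal (measurableSet_singleton _).compl).1 hF.integrableOn
  have hGi : Integrable G ((volume : Measure R3).toSphere.prod (.volumeIoiPow 2)) := by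
    have := hmp.integrable_comp_emb hemb (g := G)
    simp only [finrank_euclideanSpace, Fintype.card_fin] at this
    refine this.1 ?_
    simpa only [Function.comp_def, hcomp] using hFc
  have h1 : ∫ z, F z = ∫ p, G p ∂((volume : Measure R3).toSphere.prod (.volumeIoiPow 2)) := by
    have := hmp.integral_comp hemb G
    simp only [finrank_euclideanSpace, Fintype.card_fin, hcomp] at this
    rw [← this, integral_subtype_comap (measurableSet_singleton _).compl F,
      restrict_compl_singleton]
  rw [h1, integral_prod _ hGi]
  have h2 : ∀ e : sphere (0 : R3) 1, ∫ r, G (e, r) ∂(Measure.volumeIoiPow 2) = c := by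
    intro e
    rw [← h e (by simp)]
    simp only [Measure.volumeIoiPow, ENNReal.ofReal]
    rw [integral_withDensity_eq_integral_smul,
      integral_subtype_comap measurableSet_Ioi fun a => Real.toNNReal (a ^ 2) • F (a • e.1),
      setIntegral_congr_fun measurableSet_Ioi fun x hx => ?_]
    · rw [NNReal.smul_def, Real.coe_toNNReal _ (by positivity), Complex.real_smul]
      push_cast
      rfl
    · exact (measurable_subtype_coe.pow_const _).real_toNNReal
  simp only [h2, integral_const, Measure.toSphere_real_apply_univ]
  simp [measureReal_def, EuclideanSpace.volume_ball_fin_three, Complex.real_smul]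
  left
  rw [ENNReal.toReal_ofReal (by positivity)]
  push_cast
  ring

/-- The distributional identity `(Δ + k²) hker = -δ₀`, after one integration by parts. -/
lemma integral_kerRad_mul_fderiv_sub {φ : R3 → ℂ} (k : ℝ) (hφ : ContDiff ℝ 1 φ)
    (hc : HasCompactSupport φ)
    (hint : Integrable fun z => kerRad k z * fderiv ℝ φ z z - (k : ℂ) ^ 2 * hker k z * φ z) :
    ∫ z, (kerRad k z * fderiv ℝ φ z z - (k : ℂ) ^ 2 * hker k z * φ z) = φ 0 := by
  have hpi : (π : ℂ) ≠ 0 := by exact_mod_cast Real.pi_ne_zero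
  rw [integral_eq_of_radial_integral hint (c := (4 * (π : ℂ))⁻¹ * φ 0)]
  · field_simp
  intro e he
  set w : ℝ → ℂ := fun r => Complex.exp (Complex.I * k * r) * (Complex.I * k * r - 1) * φ (r • e)
    with hw
  have hline : ContDiff ℝ 1 fun r : ℝ => φ (r • e) := hφ.comp (contDiff_id.smul contDiff_const)
  have hcast : ContDiff ℝ 1 fun r : ℝ => (r : ℂ) := Complex.ofRealCLM.contDiff
  have hw1 : ContDiff ℝ 1 w := by
    refine (ContDiff.mul ?_ ?_).mul hline
    · exact (contDiff_const.mul hcast).cexp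
    · exact (contDiff_const.mul hcast).sub contDiff_const
  have hwc : HasCompactSupport w := by
    have : HasCompactSupport fun r : ℝ => φ (r • e) := by
      refine hc.comp_isClosedEmbedding (g := fun r : ℝ => r • e)
        (Isometry.isClosedEmbedding (Isometry.of_dist_eq fun a b => ?_))
      rw [dist_eq_norm, ← sub_smul, norm_smul, he, mul_one, Real.dist_eq, Real.norm_eq_abs]
    exact this.mul_left
  have hderiv : ∀ r : ℝ, deriv w r = Complex.exp (Complex.I * k * r) * (-(k : ℂ) ^ 2 * r) *
    φ (r • e)
      + Complex.exp (Complex.I * k * r) * (Complex.I * k * r - 1) * fderiv ℝ φ (r • e) e := by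
    intro r
    have h1 : HasDerivAt (fun r : ℝ => Complex.I * (k : ℂ) * (r : ℂ)) (Complex.I * k) r := by
      simpa using (Complex.ofRealCLM.hasDerivAt (x := r)).const_mul (Complex.I * (k : ℂ))
    have h2 : HasDerivAt (fun r : ℝ => φ (r • e)) (fderiv ℝ φ (r • e) e) r := by
      have h3 : HasDerivAt (fun r : ℝ => r • e) e r := by
        simpa using (hasDerivAt_id r).smul_const e
      exact (hφ.differentiable one_ne_zero (r • e)).hasFDerivAt.comp_hasDerivAt r h3
    refine ((h1.cexp.mul (h1.sub_const 1)).mul h2).deriv.trans ?_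
    simp only [Pi.mul_apply]
    linear_combination (-Complex.exp (Complex.I * k * r) * k ^ 2 * r * φ (r • e)) * (-Complex.I_sq)
  have hkey := hwc.integral_Ioi_deriv_eq hw1 0
  have : ∀ r ∈ Ioi (0 : ℝ), (r : ℂ) ^ 2 * (kerRad k (r • e) * fderiv ℝ φ (r • e) (r • e)
      - (k : ℂ) ^ 2 * hker k (r • e) * φ (r • e)) = (4 * (π : ℂ))⁻¹ * deriv w r := by
    intro r hr
    have hr0 : (0 : ℝ) < r := hr
    have hr' : (r : ℂ) ≠ 0 := by exact_mod_cast hr0.ne'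
    have hn : ‖r • e‖ = r := by rw [norm_smul, he, mul_one, Real.norm_of_nonneg hr0.le]
    rw [hderiv, kerRad, hker, hn, map_smul, Complex.real_smul]
    field_simp
    ring
  rw [setIntegral_congr_fun measurableSet_Ioi this, integral_const_mul, hkey]
  simp [hw]

end Kernel

section Potential

open Set Metric Filter
open scoped Convolution

lemma hasDerivAt_norm_comp_line (a v : R3) (t : ℝ) (h : a + t • v ≠ 0) :
    HasDerivAt (fun s : ℝ => ‖a + s • v‖) (inner ℝ (a + t • v) v / ‖a + t • v‖) t := by
  have h1 : HasDerivAt (fun s : ℝ => a + s • v) v t := by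
    simpa using ((hasDerivAt_id t).smul_const v).const_add a
  have h2 := h1.norm_sq.sqrt (by positivity)
  simp only [Real.sqrt_sq (norm_nonneg _)] at h2
  convert h2 using 1
  rw [mul_div_mul_left _ _ two_ne_zero]

lemma hasDerivAt_ker_comp_line (k : ℝ) (a v : R3) (t : ℝ) (h : a + t • v ≠ 0) :
    HasDerivAt (fun s : ℝ => hker k (a + s • v)) (kerD k v (a + t • v)) t := by
  have hn := (hasDerivAt_norm_comp_line a v t h).ofReal_comp
  have hz : ((‖a + t • v‖ : ℝ) : ℂ) ≠ 0 := by exact_mod_cast (norm_ne_zero_iff.2 h)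
  have hpi : (π : ℂ) ≠ 0 := by exact_mod_cast Real.pi_ne_zero
  have h3 := (hn.const_mul (Complex.I * k)).cexp.div (hn.const_mul (4 * (π : ℂ)))
    (by simp [hz, hpi, -Complex.ofReal_eq_zero])
  refine h3.congr_deriv ?_
  rw [kerD, kerRad]
  push_cast
  field_simp

/-- The Helmholtz volume potential of a density. -/
def pot (k : ℝ) (u : R3 → ℂ) (x : R3) : ℂ := ∫ y, g k x y * u y

lemma pot_eq_convolution (k : ℝ) (u : R3 → ℂ) :
    pot k u = hker k ⋆[ContinuousLinearMap.mul ℝ ℂ, volume] u := by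
  ext x
  rw [convolution_eq_swap]
  rfl

lemma pot_eq_integral_sub (k : ℝ) (u : R3 → ℂ) (x : R3) :
    pot k u x = ∫ z, hker k z * u (x - z) := by
  rw [pot_eq_convolution]
  rfl

/-- The potential of a density against the directional derivative of the kernel. -/
def potD (k : ℝ) (v : R3) (u : R3 → ℂ) : R3 → ℂ :=
  kerD k v ⋆[ContinuousLinearMap.mul ℝ ℂ, volume] u

lemma potD_eq_integral (k : ℝ) (v : R3) (u : R3 → ℂ) (x : R3) :
    potD k v u x = ∫ y, kerD k v (x - y) * u y := by
  rw [potD, convolution_eq_swap]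
  rfl

variable {u : R3 → ℂ}

lemma continuous_potD (k : ℝ) (v : R3) (hu : Continuous u) (hc : HasCompactSupport u) :
    Continuous (potD k v u) :=
  hc.continuous_convolution_right _ (locallyIntegrable_kerD k v) hu

lemma integrable_ker_mul (k : ℝ) (hu : Continuous u) (hc : HasCompactSupport u) (x : R3) :
    Integrable fun y => hker k (x - y) * u y := by
  have := hc.convolutionExists_right (ContinuousLinearMap.mul ℝ ℂ) (locallyIntegrable_ker k) hu x
  exact this.integrable_swap

lemma integrable_kerD_mul (k : ℝ) (v : R3) (hu : Continuous u) (hc : HasCompactSupport u)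
    (x : R3) : Integrable fun y => kerD k v (x - y) * u y := by
  have := hc.convolutionExists_right (ContinuousLinearMap.mul ℝ ℂ) (locallyIntegrable_kerD k v) hu x
  exact this.integrable_swap

lemma potD_eq_sum (k : ℝ) (v : R3) (hu : Continuous u) (hc : HasCompactSupport u) (x : R3) :
    potD k v u x = ∑ j, (v j : ℂ) * potD k (EuclideanSpace.single j 1) u x := by
  simp only [potD_eq_integral]
  simp only [← integral_const_mul]
  rw [← integral_finsetSum _ fun j _ => (integrable_kerD_mul k _ hu hc x).const_mul _]
  congr 1 with y
  simp only [kerD, PiLp.inner_apply, Fin.sum_univ_three]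
  simp
  ring

lemma measurable_kerD_segment (k : ℝ) (v : R3) (hu : Continuous u) (x : R3) :
    Measurable fun p : R3 × ℝ => kerD k v (x + p.2 • v - p.1) * u p.1 := by
  have h1 : Measurable fun p : R3 × ℝ => x + p.2 • v - p.1 := by fun_prop
  exact ((measurable_kerD k v).comp h1).mul (hu.measurable.comp measurable_fst)

lemma continuous_integral_norm_kerD_mul (k : ℝ) (v : R3) (hu : Continuous u)
    (hc : HasCompactSupport u) : Continuous fun x => ∫ y, ‖kerD k v (x - y) * u y‖ := by
  have hcont : Continuous ((fun z => ‖kerD k v z‖) ⋆[ContinuousLinearMap.mul ℝ ℝ, volume]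
      fun y => ‖u y‖) :=
    hc.norm.continuous_convolution_right _ ((locallyIntegrable_kerD k v).mono
      (measurable_kerD k v).norm.aestronglyMeasurable (by simp)) hu.norm
  convert hcont using 1
  ext x
  rw [convolution_eq_swap]
  simp

lemma integrable_prod_kerD (k : ℝ) (v : R3) (hu : Continuous u) (hc : HasCompactSupport u)
    (x : R3) : Integrable (fun p : R3 × ℝ => kerD k v (x + p.2 • v - p.1) * u p.1)
      ((volume : Measure R3).prod ((volume : Measure ℝ).restrict (Ioc 0 1))) := by
  have hm := (measurable_kerD_segment k v hu x).aestronglyMeasurable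
    (μ := (volume : Measure R3).prod ((volume : Measure ℝ).restrict (Ioc 0 1)))
  rw [integrable_prod_iff' hm]
  have h0 : ∀ t : ℝ, Integrable fun y => kerD k v (x + t • v - y) * u y :=
    fun t => integrable_kerD_mul k v hu hc (x + t • v)
  refine ⟨Filter.Eventually.of_forall h0, ?_⟩
  have h1 : Continuous fun t : ℝ => x + t • v := by fun_prop
  have h2 := (continuous_integral_norm_kerD_mul k v hu hc).comp h1
  have h3 : IntegrableOn _ (Ioc (0 : ℝ) 1) volume := h2.integrableOn_Ioc
  exact h3

lemma pot_add_sub (k : ℝ) (v : R3) (hu : Continuous u) (hc : HasCompactSupport u) (x : R3) :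
    pot k u (x + v) - pot k u x = ∫ t in (0 : ℝ)..1, potD k v u (x + t • v) := by
  rcases eq_or_ne v 0 with rfl | hv
  · simp [potD_eq_integral, kerD]
  have hI := integrable_prod_kerD k v hu hc x
  have hswap := integral_integral_swap (f := fun y t => kerD k v (x + t • v - y) * u y) hI
  rw [intervalIntegral.integral_of_le zero_le_one]
  simp only [potD_eq_integral]
  rw [← hswap]
  change (∫ y, hker k (x + v - y) * u y) - (∫ y, hker k (x - y) * u y) = _
  rw [← integral_sub (integrable_ker_mul k hu hc _) (integrable_ker_mul k hu hc _)]
  have hline : volume ((AffineSubspace.mk' x (Submodule.span ℝ {v}) : AffineSubspace ℝ R3) : Set R3)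
      = 0 := by
    refine Measure.addHaar_affineSubspace _ _ fun h => ?_
    have h2 : Submodule.span ℝ {v} = ⊤ := by
      rw [← AffineSubspace.direction_mk' x (Submodule.span ℝ {v}), h, AffineSubspace.direction_top]
    have h3 := finrank_span_singleton (K := ℝ) hv
    rw [h2, finrank_top] at h3
    simp at h3
  have hint := hI.prod_right_ae
  refine integral_congr_ae ?_
  filter_upwards [compl_mem_ae_iff.2 hline, hint] with y hy hyint
  have hne : ∀ t : ℝ, (x - y) + t • v ≠ 0 := by
    intro t h0
    apply hy
    rw [SetLike.mem_coe, AffineSubspace.mem_mk', Submodule.mem_span_singleton]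
    refine ⟨t, ?_⟩
    rw [vsub_eq_sub, ← sub_eq_zero, ← h0]
    abel
  have hd : ∀ t ∈ uIcc (0 : ℝ) 1, HasDerivAt (fun s : ℝ => hker k ((x - y) + s • v) * u y)
      (kerD k v (x + t • v - y) * u y) t := by
    intro t _
    rw [show x + t • v - y = (x - y) + t • v by abel]
    exact (hasDerivAt_ker_comp_line k _ v t (hne t)).mul_const _
  have := intervalIntegral.integral_eq_sub_of_hasDerivAt hd
    ((intervalIntegrable_iff_integrableOn_Ioc_of_le zero_le_one).2 hyint)
  rw [intervalIntegral.integral_of_le zero_le_one] at this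
  rw [this]
  simp only [hker, one_smul, zero_smul, add_zero]
  rw [show x + v - y = x - y + v by abel]

lemma hasFDerivAt_of_segment_integral {F : R3 → ℂ} {W : Fin 3 → R3 → ℂ}
    (hW : ∀ j, Continuous (W j))
    (h : ∀ x v : R3, F (x + v) - F x = ∫ t in (0 : ℝ)..1, ∑ j, (v j : ℂ) * W j (x + t • v))
    (x : R3) : HasFDerivAt F
      (∑ j, (EuclideanSpace.proj j : R3 →L[ℝ] ℝ).smulRight (W j x)) x := by
  rw [hasFDerivAt_iff_isLittleO_nhds_zero, Asymptotics.isLittleO_iff]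
  intro c hc
  have hev : ∀ j, ∃ δ > 0, ∀ y, ‖y‖ < δ → ‖W j (x + y) - W j x‖ < c / 3 := by
    intro j
    obtain ⟨δ, hδ, h⟩ := Metric.continuousAt_iff.1 ((hW j).continuousAt (x := x)) (c / 3)
      (by positivity)
    refine ⟨δ, hδ, fun y hy => ?_⟩
    have := h (x := x + y) (by simpa [dist_eq_norm] using hy)
    rwa [dist_eq_norm] at this
  choose δ hδ hW' using hev
  have hm : 0 < min (δ 0) (min (δ 1) (δ 2)) := by simp [hδ]
  filter_upwards [Metric.ball_mem_nhds (0 : R3) hm] with v hv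
  rw [mem_ball_zero_iff] at hv
  have hvj : ∀ j, ‖v‖ < δ j := by
    intro j
    fin_cases j <;> simp at hv ⊢ <;> tauto
  have hL : (∑ j, (EuclideanSpace.proj j : R3 →L[ℝ] ℝ).smulRight (W j x)) v
      = ∫ t in (0 : ℝ)..1, ∑ j, (v j : ℂ) * W j x := by
    simp
  rw [hL, h x v, ← intervalIntegral.integral_sub]
  · refine (intervalIntegral.norm_integral_le_of_norm_le_const (C := c * ‖v‖) fun t ht => ?_).trans
      (by simp)
    rw [uIoc_of_le zero_le_one] at ht
    rw [← Finset.sum_sub_distrib]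
    have htv : ∀ j, ‖t • v‖ < δ j := fun j => by
      refine lt_of_le_of_lt ?_ (hvj j)
      rw [norm_smul, Real.norm_of_nonneg ht.1.le]
      exact mul_le_of_le_one_left (norm_nonneg _) ht.2
    calc _ ≤ ∑ j : Fin 3, ‖(v j : ℂ) * W j (x + t • v) - (v j : ℂ) * W j x‖ := norm_sum_le _ _
      _ ≤ ∑ j : Fin 3, ‖v‖ * (c / 3) := by
        refine Finset.sum_le_sum fun j _ => ?_
        rw [← mul_sub, norm_mul, Complex.norm_real]
        gcongr
        · exact PiLp.norm_apply_le v j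
        · exact (hW' j _ (htv j)).le
      _ = c * ‖v‖ := by simp; ring
  · apply Continuous.intervalIntegrable
    fun_prop
  · exact intervalIntegrable_const

lemma hasFDerivAt_pot (k : ℝ) (hu : Continuous u) (hc : HasCompactSupport u) (x : R3) :
    HasFDerivAt (pot k u) (∑ j, (EuclideanSpace.proj j : R3 →L[ℝ] ℝ).smulRight
      (potD k (EuclideanSpace.single j 1) u x)) x := by
  refine hasFDerivAt_of_segment_integral (fun j => continuous_potD k _ hu hc) (fun x v => ?_) x
  rw [pot_add_sub k v hu hc]
  simp only [potD_eq_sum k v hu hc]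

lemma contDiff_one_pot (k : ℝ) (hu : Continuous u) (hc : HasCompactSupport u) :
    ContDiff ℝ 1 (pot k u) := by
  rw [contDiff_one_iff_hasFDerivAt]
  refine ⟨_, ?_, hasFDerivAt_pot k hu hc⟩
  refine continuous_finsetSum _ fun j _ => ?_
  have := continuous_potD k (EuclideanSpace.single j (1 : ℝ)) hu hc
  exact (ContinuousLinearMap.smulRightL ℝ R3 ℂ (EuclideanSpace.proj j)).continuous.comp this

lemma pd_pot (k : ℝ) (hu : Continuous u) (hc : HasCompactSupport u) (j : Fin 3) (x : R3) :
    pd j (pot k u) x = potD k (EuclideanSpace.single j 1) u x := by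
  rw [pd, (hasFDerivAt_pot k hu hc x).fderiv]
  simp

lemma pd_pot_eq_pot_pd (k : ℝ) (hu : ContDiff ℝ 1 u) (hc : HasCompactSupport u) (j : Fin 3) :
    pd j (pot k u) = pot k (pd j u) := by
  ext x
  rw [pot_eq_convolution, pot_eq_convolution, pd,
    (hc.hasFDerivAt_convolution_right _ (locallyIntegrable_ker k) hu x).fderiv]
  rw [convolution_precompR_apply _ (locallyIntegrable_ker k) (hc.fderiv ℝ)
    (hu.continuous_fderiv one_ne_zero)]
  rfl

lemma contDiff_two_of_pd {F : R3 → ℂ} (hd : ContDiff ℝ 1 F) (h : ∀ j, ContDiff ℝ 1 (pd j F)) :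
    ContDiff ℝ 2 F := by
  rw [show (2 : ℕ∞ω) = 1 + 1 by norm_num, contDiff_succ_iff_fderiv]
  refine ⟨hd.differentiable one_ne_zero, by simp, ?_⟩
  rw [contDiff_clm_apply_iff]
  intro v
  simp only [fderiv_eq_sum_pd F _ v]
  exact ContDiff.sum fun j _ => contDiff_const.mul (h j)

lemma contDiff_two_pot (k : ℝ) (hu : ContDiff ℝ 1 u) (hc : HasCompactSupport u) :
    ContDiff ℝ 2 (pot k u) := by
  refine contDiff_two_of_pd (contDiff_one_pot k hu.continuous hc) fun j => ?_
  rw [pd_pot_eq_pot_pd k hu hc]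
  exact contDiff_one_pot k (hu.continuous_pd j) (hc.pd j)

lemma lap_pot (k : ℝ) (hu : ContDiff ℝ 1 u) (hc : HasCompactSupport u) (x : R3) :
    lap (pot k u) x = -(k : ℂ) ^ 2 * pot k u x - u x := by
  set φ : R3 → ℂ := fun z => u (x - z) with hφ
  have hφ1 : ContDiff ℝ 1 φ := hu.comp (contDiff_const.sub contDiff_id)
  have hφc : HasCompactSupport φ := hc.comp_homeomorph (Homeomorph.subLeft x)
  have hφd : ∀ z, fderiv ℝ φ z z = -∑ j, (z j : ℂ) * pd j u (x - z) := by
    intro z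
    have h1 : HasFDerivAt φ ((fderiv ℝ u (x - z)).comp (-ContinuousLinearMap.id ℝ R3)) z := by
      refine (hu.differentiable one_ne_zero (x - z)).hasFDerivAt.comp z ?_
      simpa using (hasFDerivAt_id (𝕜 := ℝ) z).const_sub x
    rw [h1.fderiv, ← fderiv_eq_sum_pd]
    simp
  have hl : lap (pot k u) x = ∫ z, ∑ j, kerD k (EuclideanSpace.single j 1) z * pd j u (x - z) := by
    rw [integral_finsetSum]
    · refine Finset.sum_congr rfl fun j _ => ?_
      rw [pd_pot_eq_pot_pd k hu hc, pd_pot k (hu.continuous_pd j) (hc.pd j)]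
      rfl
    · intro j _
      exact ((hc.pd j).convolutionExists_right (ContinuousLinearMap.mul ℝ ℂ)
        (locallyIntegrable_kerD k _) (hu.continuous_pd j) x)
  have hI1 : Integrable fun z => ∑ j, kerD k (EuclideanSpace.single j 1) z * pd j u (x - z) := by
    refine integrable_finsetSum _ fun j _ => ?_
    exact ((hc.pd j).convolutionExists_right (ContinuousLinearMap.mul ℝ ℂ)
        (locallyIntegrable_kerD k _) (hu.continuous_pd j) x)
  have hI2 : Integrable fun z => hker k z * u (x - z) :=
    hc.convolutionExists_right (ContinuousLinearMap.mul ℝ ℂ) (locallyIntegrable_ker k)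
      hu.continuous x
  have heq : (fun z => kerRad k z * fderiv ℝ φ z z - (k : ℂ) ^ 2 * hker k z * φ z) = fun z =>
      -((∑ j, kerD k (EuclideanSpace.single j 1) z * pd j u (x - z)) +
        (k : ℂ) ^ 2 * (hker k z * u (x - z))) := by
    ext z
    rw [hφd]
    simp only [kerD, PiLp.inner_apply, Fin.sum_univ_three, hφ]
    simp
    ring
  have hkey := integral_kerRad_mul_fderiv_sub k hφ1 hφc
    (by rw [heq]; exact (hI1.add (hI2.const_mul _)).neg)
  rw [heq, integral_neg, integral_add hI1 (hI2.const_mul _), integral_const_mul, ← hl,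
    ← pot_eq_integral_sub] at hkey
  simp only [hφ, sub_zero] at hkey
  linear_combination -hkey

end Potential

section FarField

open Set Metric Filter
open scoped Convolution

/-- The outgoing kernel rescaled at infinity: for `s > 0` it equals
`s⁻¹ e^{-ik‖x‖/s} hker k (x / s - y)`, and it extends smoothly across `s = 0`. -/
def farKer (k : ℝ) (q : ℝ × R3) (y : R3) : ℂ :=
  Complex.exp (Complex.I * (k : ℂ) *
      (((-2 * inner ℝ q.2 y + q.1 * ‖y‖ ^ 2) / (‖q.2 - q.1 • y‖ + ‖q.2‖) : ℝ) : ℂ))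
    / (4 * (Real.pi : ℂ) * (‖q.2 - q.1 • y‖ : ℝ))

/-- The domain of the rescaled far field of a source supported in `closedBall 0 R`. -/
def farDom (R : ℝ) : Set (ℝ × R3) := {q | |q.1| * (2 * R) < ‖q.2‖}

/-- The far field of a source, rescaled at infinity. -/
def farField (k : ℝ) (f : R3 → ℂ) (q : ℝ × R3) : ℂ := ∫ y, f y * farKer k q y

lemma isOpen_farDom (R : ℝ) : IsOpen (farDom R) := by
  apply isOpen_lt <;> fun_prop

variable {R : ℝ}

lemma ne_zero_of_mem_farDom (hR : 0 < R) {q : ℝ × R3} (hq : q ∈ farDom R) : q.2 ≠ 0 := by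
  have h : |q.1| * (2 * R) < ‖q.2‖ := hq
  exact norm_pos_iff.1 (lt_of_le_of_lt (by positivity) h)

lemma sub_smul_ne_zero_of_mem_farDom {q : ℝ × R3} (hq : q ∈ farDom R) {y : R3}
    (hy : ‖y‖ ≤ 2 * R) : q.2 - q.1 • y ≠ 0 := by
  intro h
  have h1 : ‖q.2‖ = |q.1| * ‖y‖ := by
    rw [sub_eq_zero.1 h, norm_smul, Real.norm_eq_abs]
  have h2 : |q.1| * (2 * R) < ‖q.2‖ := hq
  have h3 := mul_le_mul_of_nonneg_left hy (abs_nonneg q.1)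
  linarith

lemma contDiffAt_farKer (k : ℝ) {q : ℝ × R3} {y : R3} (h0 : q.2 ≠ 0) (h : q.2 - q.1 • (-y) ≠ 0) :
    ContDiffAt ℝ ∞ (fun z : (ℝ × R3) × R3 => farKer k z.1 (-z.2)) (q, y) := by
  have h1 : ContDiffAt ℝ ∞ (fun z : (ℝ × R3) × R3 => z.1.2 - z.1.1 • (-z.2)) (q, y) := by fun_prop
  have h2 := h1.norm ℝ h
  have h3 : ContDiffAt ℝ ∞ (fun z : (ℝ × R3) × R3 => ‖z.1.2‖) (q, y) :=
    ContDiffAt.norm ℝ (by fun_prop) h0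
  have h4 : ContDiffAt ℝ ∞ (fun z : (ℝ × R3) × R3 =>
      -2 * inner ℝ z.1.2 (-z.2) + z.1.1 * ‖-z.2‖ ^ 2) (q, y) := by
    refine (contDiffAt_const.mul ?_).add (ContDiffAt.mul (by fun_prop) ?_)
    · exact ContDiffAt.inner ℝ (by fun_prop) (by fun_prop)
    · exact ContDiffAt.norm_sq ℝ (by fun_prop)
  have h5 : ‖q.2 - q.1 • (-y)‖ + ‖q.2‖ ≠ 0 := by
    have := norm_pos_iff.2 h0
    positivity
  have hpi : (π : ℂ) ≠ 0 := by exact_mod_cast Real.pi_ne_zero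
  have h7 : ((‖q.2 - q.1 • (-y)‖ : ℝ) : ℂ) ≠ 0 := by exact_mod_cast norm_ne_zero_iff.2 h
  have hof : ContDiff ℝ ∞ (fun t : ℝ => (t : ℂ)) := Complex.ofRealCLM.contDiff
  have h8 : ContDiffAt ℝ ∞ (fun z : (ℝ × R3) × R3 => ((
      (-2 * inner ℝ z.1.2 (-z.2) + z.1.1 * ‖-z.2‖ ^ 2) /
        (‖z.1.2 - z.1.1 • (-z.2)‖ + ‖z.1.2‖) : ℝ) : ℂ))
      (q, y) := hof.contDiffAt.comp _ (h4.div (h2.add h3) h5)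
  have h9 : ContDiffAt ℝ ∞ (fun z : (ℝ × R3) × R3 => ((‖z.1.2 - z.1.1 • (-z.2)‖ : ℝ) : ℂ)) (q, y) :=
    hof.contDiffAt.comp _ h2
  simp only [farKer, div_eq_mul_inv (Complex.exp _)]
  refine (contDiffAt_const.mul h8).cexp.mul ((contDiffAt_const.mul h9).inv ?_)
  exact mul_ne_zero (mul_ne_zero (by norm_num : (4 : ℂ) ≠ 0) hpi) h7

lemma contDiffOn_bump_mul_farKer (k : ℝ) (hR : 0 < R) (b : ContDiffBump (0 : R3))
    (hb : b.rOut = 2 * R) :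
    ContDiffOn ℝ ∞ (fun w : (ℝ × R3) × R3 => (b w.2 : ℂ) * farKer k w.1 (-w.2))
      (farDom R ×ˢ univ) := by
  have hof : ContDiff ℝ ∞ (fun t : ℝ => (t : ℂ)) := Complex.ofRealCLM.contDiff
  rintro ⟨q, z⟩ ⟨hq, -⟩
  refine ContDiffAt.contDiffWithinAt ?_
  by_cases hz : ‖z‖ ≤ 2 * R
  · have hb1 : ContDiff ℝ ∞ (fun w : (ℝ × R3) × R3 => (b w.2 : ℂ)) :=
      hof.comp (b.contDiff.comp contDiff_snd)
    refine hb1.contDiffAt.mul ?_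
    have h1 := contDiffAt_farKer k (ne_zero_of_mem_farDom hR hq)
      (sub_smul_ne_zero_of_mem_farDom hq (y := -z) (by simpa using hz))
    exact h1
  · have hev : ∀ᶠ w : (ℝ × R3) × R3 in 𝓝 (q, z), (b w.2 : ℂ) * farKer k w.1 (-w.2) = 0 := by
      have : ∀ᶠ w : (ℝ × R3) × R3 in 𝓝 (q, z), 2 * R < ‖w.2‖ :=
        (continuous_snd.norm.tendsto (q, z)).eventually (lt_mem_nhds (not_le.1 hz))
      filter_upwards [this] with w hw
      have hb : b w.2 = 0 := b.zero_of_le_dist (by simpa [hb] using hw.le)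
      simp [hb]
    exact contDiffAt_const.congr_of_eventuallyEq hev

variable {f : R3 → ℂ}

lemma contDiffOn_farField (k : ℝ) (hR : 0 < R) (hf : LocallyIntegrable f)
    (hsupp : ∀ y, R < ‖y‖ → f y = 0) : ContDiffOn ℝ ∞ (farField k f) (farDom R) := by
  obtain ⟨b, hbi, hbo⟩ : ∃ b : ContDiffBump (0 : R3), b.rIn = R ∧ b.rOut = 2 * R :=
    ⟨⟨R, 2 * R, hR, by linarith⟩, rfl, rfl⟩
  have hzero : ∀ (q : ℝ × R3) (z : R3), q ∈ farDom R → z ∉ closedBall (0 : R3) (2 * R) →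
      (b z : ℂ) * farKer k q (-z) = 0 := by
    intro q z _ hz
    have hz' : 2 * R < ‖z‖ := by simpa using hz
    have hb : b z = 0 := b.zero_of_le_dist (by simpa [hbo] using hz'.le)
    simp [hb]
  have hconv := contDiffOn_convolution_right_with_param_comp (n := ⊤)
    (ContinuousLinearMap.mul ℝ ℂ) (μ := (volume : Measure R3)) (f := f)
    (g := fun q z => (b z : ℂ) * farKer k q (-z))
    (v := fun _ => (0 : R3)) (s := farDom R) contDiffOn_const (isOpen_farDom R)
    (isCompact_closedBall (0 : R3) (2 * R)) hzero hf (contDiffOn_bump_mul_farKer k hR b hbo)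
  refine hconv.congr fun q hq => ?_
  rw [farField, convolution_def]
  refine integral_congr_ae (.of_forall fun y => ?_)
  simp only [zero_sub, neg_neg, ContinuousLinearMap.mul_apply']
  by_cases hy : R < ‖y‖
  · simp [hsupp y hy]
  · have hb : b (-y) = 1 := b.one_of_mem_closedBall (by simpa [hbi] using hy)
    simp [hb]

lemma farKer_eq (k : ℝ) {q : ℝ × R3} (hs : 0 < q.1) (h0 : q.2 ≠ 0) {y : R3}
    (h : q.2 - q.1 • y ≠ 0) :
    farKer k q y = (q.1 : ℂ)⁻¹ * Complex.exp (-(Complex.I * k * (‖q.2‖ / q.1 : ℝ))) *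
      hker k (q.1⁻¹ • q.2 - y) := by
  obtain ⟨s, x⟩ := q
  simp only at *
  have h1 : s⁻¹ • x - y = s⁻¹ • (x - s • y) := by
    rw [smul_sub, smul_smul, inv_mul_cancel₀ hs.ne', one_smul]
  have hn : ‖s⁻¹ • x - y‖ = ‖x - s • y‖ / s := by
    rw [h1, norm_smul, Real.norm_of_nonneg (by positivity)]
    ring
  have hd : 0 < ‖x - s • y‖ := norm_pos_iff.2 h
  have hx : 0 < ‖x‖ := norm_pos_iff.2 h0
  have hphase : (-2 * inner ℝ x y + s * ‖y‖ ^ 2) / (‖x - s • y‖ + ‖x‖) =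
      ‖x - s • y‖ / s - ‖x‖ / s := by
    have hsq : ‖x - s • y‖ ^ 2 = ‖x‖ ^ 2 - 2 * (s * inner ℝ x y) + s ^ 2 * ‖y‖ ^ 2 := by
      rw [norm_sub_sq_real, inner_smul_right, norm_smul, mul_pow, Real.norm_eq_abs, sq_abs]
    rw [div_eq_iff (by positivity), ← sub_div, div_mul_eq_mul_div, eq_div_iff hs.ne']
    linear_combination -hsq
  rw [farKer, hker, hn]
  simp only
  rw [hphase]
  have he : Complex.I * (k : ℂ) * ((‖x - s • y‖ / s - ‖x‖ / s : ℝ) : ℂ) =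
      -(Complex.I * k * (‖x‖ / s : ℝ)) + Complex.I * k * (‖x - s • y‖ / s : ℝ) := by
    push_cast; ring
  rw [he, Complex.exp_add]
  have hs' : (s : ℂ) ≠ 0 := by exact_mod_cast hs.ne'
  have hd' : ((‖x - s • y‖ : ℝ) : ℂ) ≠ 0 := by exact_mod_cast hd.ne'
  have hpi : (π : ℂ) ≠ 0 := by exact_mod_cast Real.pi_ne_zero
  push_cast
  field_simp

lemma farField_eq_pot (k : ℝ) (hR : 0 < R) (hsupp : ∀ y, R < ‖y‖ → f y = 0) {q : ℝ × R3}
    (hq : q ∈ farDom R) (hs : 0 < q.1) :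
    farField k f q = (q.1 : ℂ)⁻¹ * Complex.exp (-(Complex.I * k * (‖q.2‖ / q.1 : ℝ))) *
      pot k f (q.1⁻¹ • q.2) := by
  rw [farField, pot, ← integral_const_mul]
  congr 1 with y
  by_cases hy : R < ‖y‖
  · simp [hsupp y hy]
  · rw [farKer_eq k hs (ne_zero_of_mem_farDom hR hq)
      (sub_smul_ne_zero_of_mem_farDom hq (by linarith [not_lt.1 hy]))]
    simp only [hker, g]
    ring

lemma farField_smul (k : ℝ) (f : R3 → ℂ) {c : ℝ} (hc : 0 < c) (q : ℝ × R3) :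
    farField k f (c • q) = (c : ℂ)⁻¹ * farField k f q := by
  rw [farField, farField, ← integral_const_mul]
  congr 1 with y
  have h1 : c • q.2 - (c * q.1) • y = c • (q.2 - q.1 • y) := by
    rw [smul_sub, smul_smul]
  have hc' : (c : ℂ) ≠ 0 := by exact_mod_cast hc.ne'
  simp only [farKer, Prod.smul_fst, Prod.smul_snd, smul_eq_mul, h1, norm_smul,
    Real.norm_of_nonneg hc.le, real_inner_smul_left]
  have h2 : (-2 * (c * inner ℝ q.2 y) + c * q.1 * ‖y‖ ^ 2) /
      (c * ‖q.2 - q.1 • y‖ + c * ‖q.2‖) =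
      (-2 * inner ℝ q.2 y + q.1 * ‖y‖ ^ 2) / (‖q.2 - q.1 • y‖ + ‖q.2‖) := by
    rw [← mul_add, ← mul_div_mul_left _ (‖q.2 - q.1 • y‖ + ‖q.2‖) hc.ne']
    congr 1
    ring
  rw [h2]
  push_cast
  rw [mul_left_comm (4 * (π : ℂ)), div_mul_eq_div_div_swap, div_eq_inv_mul _ (c : ℂ)]
  ring

end FarField

section FarFieldPDE

open Set Metric Filter

lemma pd_comp_smul (j : Fin 3) (u : R3 → ℂ) (c : ℝ) (x : R3) :
    pd j (fun y => u (c • y)) x = c * pd j u (c • x) := by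
  rw [pd, fderiv_comp_smul]
  simp [pd]

lemma lap_comp_smul (u : R3 → ℂ) (c : ℝ) (x : R3) :
    lap (fun y => u (c • y)) x = (c : ℂ) ^ 2 * lap u (c • x) := by
  simp only [lap, Finset.mul_sum]
  refine Finset.sum_congr rfl fun j _ => ?_
  have h : pd j (fun y => u (c • y)) = fun x => c * pd j u (c • x) :=
    funext fun x => pd_comp_smul j u c x
  rw [h]
  have h1 := pd_comp_smul j (fun y => (c : ℂ) * pd j u y) c x
  have h2 : pd j (fun y => (c : ℂ) * pd j u y) (c • x) = c * pd j (pd j u) (c • x) := by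
    have := fderiv_const_smul_field (𝕜 := ℝ) (c : ℂ) (f := pd j u)
    rw [pd, show (fun y => (c : ℂ) * pd j u y) = (c : ℂ) • pd j u from rfl, this]
    simp [pd]
  rw [h1, h2]
  ring

lemma lap_mul {u v : R3 → ℂ} {x : R3} (hu : ContDiffAt ℝ 2 u x) (hv : ContDiffAt ℝ 2 v x) :
    lap (fun y => u y * v y) x =
      lap u x * v x + 2 * ∑ j, pd j u x * pd j v x + u x * lap v x := by
  simp only [lap, Finset.mul_sum, Finset.sum_mul, ← Finset.sum_add_distrib]
  refine Finset.sum_congr rfl fun j _ => ?_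
  have hev : pd j (fun y => u y * v y) =ᶠ[𝓝 x] fun y => pd j u y * v y + u y * pd j v y := by
    filter_upwards [hu.eventually (by simp), hv.eventually (by simp)] with y h1 h2
    exact pd_mul j (h1.differentiableAt two_ne_zero) (h2.differentiableAt two_ne_zero)
  have hu1 := hu.differentiableAt two_ne_zero
  have hv1 := hv.differentiableAt two_ne_zero
  have hu2 := (hu.pd (m := 1) (by norm_num) j).differentiableAt one_ne_zero
  have hv2 := (hv.pd (m := 1) (by norm_num) j).differentiableAt one_ne_zero
  rw [pd_congr hev, pd_add j (hu2.fun_mul hv1) (hu1.fun_mul hv2), pd_mul j hu2 hv1,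
    pd_mul j hu1 hv2]
  ring

lemma hasFDerivAt_norm {x : R3} (hx : x ≠ 0) :
    HasFDerivAt (fun y : R3 => ‖y‖) (‖x‖⁻¹ • innerSL ℝ x) x := by
  have h := (hasFDerivAt_id (𝕜 := ℝ) x).norm_sq.sqrt (by simpa using hx)
  simp only [id, Real.sqrt_sq (norm_nonneg _)] at h
  refine h.congr_fderiv ?_
  ext v
  simp
  field_simp

lemma hasFDerivAt_norm_ofReal {x : R3} (hx : x ≠ 0) :
    HasFDerivAt (fun y : R3 => ((‖y‖ : ℝ) : ℂ))
      (Complex.ofRealCLM.comp (‖x‖⁻¹ • innerSL ℝ x)) x :=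
  Complex.ofRealCLM.hasFDerivAt.comp x (hasFDerivAt_norm hx)

lemma pd_norm (j : Fin 3) {x : R3} (hx : x ≠ 0) :
    pd j (fun y => ((‖y‖ : ℝ) : ℂ)) x = (x j : ℂ) / ‖x‖ := by
  rw [pd, (hasFDerivAt_norm_ofReal hx).fderiv]
  simp [PiLp.inner_apply]
  ring

lemma pd_coord (i j : Fin 3) (x : R3) :
    pd i (fun y => ((y j : ℝ) : ℂ)) x = if i = j then 1 else 0 := by
  have h : HasFDerivAt (fun y : R3 => ((y j : ℝ) : ℂ))
      (Complex.ofRealCLM.comp (EuclideanSpace.proj j : R3 →L[ℝ] ℝ)) x :=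
    (Complex.ofRealCLM.comp (EuclideanSpace.proj j : R3 →L[ℝ] ℝ)).hasFDerivAt
  rw [pd, h.fderiv]
  by_cases hij : i = j <;> simp [hij, eq_comm]

lemma contDiffAt_norm_ofReal {n : ℕ∞ω} {x : R3} (hx : x ≠ 0) :
    ContDiffAt ℝ n (fun y : R3 => ((‖y‖ : ℝ) : ℂ)) x :=
  Complex.ofRealCLM.contDiff.contDiffAt.comp x (contDiffAt_id.norm ℝ hx)

lemma contDiff_coord {n : ℕ∞ω} (j : Fin 3) : ContDiff ℝ n (fun y : R3 => ((y j : ℝ) : ℂ)) :=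
  (Complex.ofRealCLM.comp (EuclideanSpace.proj j : R3 →L[ℝ] ℝ)).contDiff

lemma sum_coord_sq (x : R3) : ∑ j, (x j : ℂ) * x j = (‖x‖ : ℂ) ^ 2 := by
  rw [← Complex.ofReal_pow, EuclideanSpace.real_norm_sq_eq]
  push_cast
  simp only [sq]

/-- The phase of an outgoing spherical wave. -/
def sphWave (c : ℂ) (x : R3) : ℂ := Complex.exp (c * (‖x‖ : ℝ))

lemma contDiffAt_sphWave {n : ℕ∞ω} (c : ℂ) {x : R3} (hx : x ≠ 0) :
    ContDiffAt ℝ n (sphWave c) x :=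
  (contDiffAt_const.mul (contDiffAt_norm_ofReal hx)).cexp

lemma pd_sphWave (c : ℂ) (j : Fin 3) {x : R3} (hx : x ≠ 0) :
    pd j (sphWave c) x = c * ((x j : ℂ) / ‖x‖) * sphWave c x := by
  have h := ((hasFDerivAt_norm_ofReal hx).const_mul c).cexp
  have h2 := pd_norm j hx
  rw [pd, (hasFDerivAt_norm_ofReal hx).fderiv] at h2
  rw [pd, show sphWave c = fun y => Complex.exp (c * (‖y‖ : ℝ)) from rfl, h.fderiv]
  rw [smul_apply, smul_apply, h2]
  simp only [smul_eq_mul]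
  ring

lemma lap_sphWave (c : ℂ) {x : R3} (hx : x ≠ 0) :
    lap (sphWave c) x = (c ^ 2 + 2 * c / ‖x‖) * sphWave c x := by
  have hn : ((‖x‖ : ℝ) : ℂ) ≠ 0 := by exact_mod_cast norm_ne_zero_iff.2 hx
  have hj : ∀ j : Fin 3, pd j (pd j (sphWave c)) x =
      (c * (1 / ‖x‖ - (x j : ℂ) * x j / ‖x‖ ^ 3) + c ^ 2 * ((x j : ℂ) * x j) / ‖x‖ ^ 2) *
        sphWave c x := by
    intro j
    have hev : pd j (sphWave c) =ᶠ[𝓝 x] fun y => c * ((y j : ℂ) * ((‖y‖ : ℂ)⁻¹ * sphWave c y)) := by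
      filter_upwards [isOpen_ne.mem_nhds hx] with y hy
      rw [pd_sphWave c j hy]
      ring
    have d1 := (contDiff_coord (n := 1) j).contDiffAt (x := x) |>.differentiableAt one_ne_zero
    have d2 := (contDiffAt_norm_ofReal (n := 1) hx).differentiableAt one_ne_zero
    have d3 := (contDiffAt_sphWave (n := 1) c hx).differentiableAt one_ne_zero
    have d4 : DifferentiableAt ℝ (fun y : R3 => ((‖y‖ : ℝ) : ℂ)⁻¹) x := d2.inv hn
    have hinv : pd j (fun y : R3 => ((‖y‖ : ℝ) : ℂ)⁻¹) x = -((x j : ℂ) / ‖x‖ ^ 3) := by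
      have h1 := pd_mul j d2 d4
      have h2 : (fun y : R3 => ((‖y‖ : ℝ) : ℂ) * ((‖y‖ : ℝ) : ℂ)⁻¹) =ᶠ[𝓝 x] fun _ => (1 : ℂ) := by
        filter_upwards [isOpen_ne.mem_nhds hx] with y hy
        exact mul_inv_cancel₀ (by exact_mod_cast norm_ne_zero_iff.2 hy)
      rw [pd_congr h2, pd_const, pd_norm j hx] at h1
      field_simp at h1 ⊢
      linear_combination -h1
    rw [pd_congr hev, pd_const_mul j c (d1.fun_mul (d4.fun_mul d3)), pd_mul j d1 (d4.fun_mul d3),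
      pd_mul j d4 d3, hinv, pd_coord, pd_sphWave c j hx]
    simp only [if_true]
    field_simp
    ring
  have hs := sum_coord_sq x
  simp only [lap, hj, Fin.sum_univ_three] at hs ⊢
  field_simp
  linear_combination (sphWave c x * (-c + c ^ 2 * ‖x‖)) * hs

end FarFieldPDE

section FarFieldFlow

open Set Metric Filter

/-- Derivative in the scaling variable. -/
def dS (F : ℝ × R3 → ℂ) (q : ℝ × R3) : ℂ := fderiv ℝ F q (1, 0)

/-- Partial derivatives in the space variable. -/
def dX (j : Fin 3) (F : ℝ × R3 → ℂ) (q : ℝ × R3) : ℂ :=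
  fderiv ℝ F q (0, EuclideanSpace.single j 1)

/-- Laplacian in the space variable. -/
def lapX (F : ℝ × R3 → ℂ) (q : ℝ × R3) : ℂ := ∑ j, dX j (dX j F) q

/-- The generator of the far field flow, so that `dS F = farGen k F` for far fields. -/
def farGen (k : ℝ) (F : ℝ × R3 → ℂ) (q : ℝ × R3) : ℂ :=
  (‖q.2‖ : ℝ) / (2 * Complex.I * k) * lapX F q

variable {F G : ℝ × R3 → ℂ} {q : ℝ × R3}

lemma dX_congr {j : Fin 3} (h : F =ᶠ[𝓝 q] G) : dX j F q = dX j G q := by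
  rw [dX, dX, h.fderiv_eq]

lemma dX_eventuallyEq {j : Fin 3} (h : F =ᶠ[𝓝 q] G) : dX j F =ᶠ[𝓝 q] dX j G :=
  h.fderiv.mono fun y hy => by rw [dX, dX, hy]

lemma lapX_congr (h : F =ᶠ[𝓝 q] G) : lapX F q = lapX G q :=
  Finset.sum_congr rfl fun _ _ => dX_congr (dX_eventuallyEq h)

lemma farGen_congr {k : ℝ} (h : F =ᶠ[𝓝 q] G) : farGen k F q = farGen k G q := by
  rw [farGen, farGen, lapX_congr h]

lemma ContDiffAt.dX (h : ContDiffAt ℝ ∞ F q) (j : Fin 3) : ContDiffAt ℝ ∞ (dX j F) q :=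
  (h.fderiv_right (m := ∞) (by simp)).clm_apply contDiffAt_const

lemma ContDiffAt.dS (h : ContDiffAt ℝ ∞ F q) : ContDiffAt ℝ ∞ (dS F) q :=
  (h.fderiv_right (m := ∞) (by simp)).clm_apply contDiffAt_const

lemma ContDiffAt.lapX (h : ContDiffAt ℝ ∞ F q) : ContDiffAt ℝ ∞ (lapX F) q :=
  ContDiffAt.sum fun j _ => (h.dX j).dX j

lemma ContDiffAt.farGen (k : ℝ) (h : ContDiffAt ℝ ∞ F q) (hq : q.2 ≠ 0) :
    ContDiffAt ℝ ∞ (farGen k F) q := by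
  have h1 : ContDiffAt ℝ ∞ (fun q : ℝ × R3 => ((‖q.2‖ : ℝ) : ℂ)) q :=
    (contDiffAt_norm_ofReal hq).comp q contDiffAt_snd
  have h2 : ContDiffAt ℝ ∞ (fun q : ℝ × R3 => ((‖q.2‖ : ℝ) : ℂ) * (2 * Complex.I * k)⁻¹) q :=
    h1.mul contDiffAt_const
  exact h2.mul h.lapX

lemma dX_eq_pd (j : Fin 3) (h : DifferentiableAt ℝ F q) :
    dX j F q = pd j (fun x => F (q.1, x)) q.2 := by
  have h1 : HasFDerivAt (fun x : R3 => (q.1, x)) (ContinuousLinearMap.inr ℝ ℝ R3) q.2 :=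
    hasFDerivAt_prodMk_right q.1 q.2
  have h2 := HasFDerivAt.comp (f := fun x : R3 => (q.1, x)) (g := F) q.2 h.hasFDerivAt h1
  rw [dX, pd, show (fun x => F (q.1, x)) = F ∘ fun x : R3 => (q.1, x) from rfl, h2.fderiv]
  simp

lemma hasDerivAt_dS (h : DifferentiableAt ℝ F q) :
    HasDerivAt (fun s => F (s, q.2)) (dS F q) q.1 := by
  have h1 : HasDerivAt (fun s : ℝ => (s, q.2)) ((1 : ℝ), (0 : R3)) q.1 :=
    (hasDerivAt_id q.1).prodMk (hasDerivAt_const q.1 q.2)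
  exact HasFDerivAt.comp_hasDerivAt (f := fun s : ℝ => (s, q.2)) q.1 h.hasFDerivAt h1

lemma dS_dX (h : ContDiffAt ℝ ∞ F q) (j : Fin 3) : dS (dX j F) q = dX j (dS F) q :=
  fderiv_fderiv_comm (h.of_le ENat.LEInfty.out) _ _

lemma dS_lapX (h : ∀ᶠ p in 𝓝 q, ContDiffAt ℝ ∞ F p) : dS (lapX F) q = lapX (dS F) q := by
  have h1 : dS (lapX F) q = ∑ j, dS (dX j (dX j F)) q := by
    rw [dS, show lapX F = fun p => ∑ j, dX j (dX j F) p from rfl, fderiv_fun_sum]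
    · simp [dS]
    · intro j _
      exact ((h.self_of_nhds.dX j).dX j).differentiableAt (by simp)
  rw [h1, lapX]
  refine Finset.sum_congr rfl fun j _ => ?_
  rw [dS_dX (h.self_of_nhds.dX j)]
  refine dX_congr ?_
  filter_upwards [h] with p hp using dS_dX hp j

lemma dS_farGen (k : ℝ) (h : ∀ᶠ p in 𝓝 q, ContDiffAt ℝ ∞ F p) (hq : q.2 ≠ 0) :
    dS (farGen k F) q = farGen k (dS F) q := by
  have h1 := hasDerivAt_dS (h.self_of_nhds.lapX.differentiableAt (by simp))
  have h2 := h1.const_mul (((‖q.2‖ : ℝ) : ℂ) / (2 * Complex.I * k))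
  have h3 := hasDerivAt_dS ((h.self_of_nhds.farGen k hq).differentiableAt (by simp))
  rw [h3.unique h2, dS_lapX h, farGen]

/-- Smooth functions on the far domain that vanish at infinity and solve the far field flow. -/
structure IsFarFlow (k R : ℝ) (F : ℝ × R3 → ℂ) : Prop where
  smooth : ∀ q ∈ farDom R, ContDiffAt ℝ ∞ F q
  zero : ∀ x : R3, x ≠ 0 → F (0, x) = 0
  flow : ∀ q ∈ farDom R, 0 < q.1 → dS F q = farGen k F q

lemma zero_mem_farDom {R : ℝ} {x : R3} (hx : x ≠ 0) : ((0 : ℝ), x) ∈ farDom R := by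
  simp [farDom, hx]

lemma dX_zero {j : Fin 3} (hs : ∀ x : R3, x ≠ 0 → ContDiffAt ℝ ∞ F (0, x))
    (h : ∀ x : R3, x ≠ 0 → F (0, x) = 0) (x : R3) (hx : x ≠ 0) : dX j F (0, x) = 0 := by
  rw [dX_eq_pd j ((hs x hx).differentiableAt (by simp))]
  have hev : (fun y : R3 => F (0, y)) =ᶠ[𝓝 x] fun _ => 0 := by
    filter_upwards [isOpen_ne.mem_nhds hx] with y hy using h y hy
  simp only [pd_congr hev, pd_const]

lemma IsFarFlow.farGen {k R : ℝ} (hR : 0 < R) (h : IsFarFlow k R F) :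
    IsFarFlow k R (farGen k F) where
  smooth q hq := (h.smooth q hq).farGen k (ne_zero_of_mem_farDom hR hq)
  zero x hx := by
    have h1 : ∀ x : R3, x ≠ 0 → ContDiffAt ℝ ∞ F (0, x) :=
      fun x hx => h.smooth _ (zero_mem_farDom hx)
    have h2 : ∀ j, dX j (dX j F) (0, x) = 0 := fun j =>
      dX_zero (fun x hx => (h1 x hx).dX j) (dX_zero h1 h.zero) x hx
    simp [_root_.farGen, _root_.lapX, h2]
  flow q hq hs := by
    have hU := (isOpen_farDom R).mem_nhds hq
    have hev : ∀ᶠ p in 𝓝 q, ContDiffAt ℝ ∞ F p := by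
      filter_upwards [hU] with p hp using h.smooth p hp
    rw [dS_farGen k hev (ne_zero_of_mem_farDom hR hq)]
    refine farGen_congr ?_
    filter_upwards [hU, (isOpen_lt continuous_const continuous_fst).mem_nhds hs] with p hp hps
    exact h.flow p hp hps

lemma IsFarFlow.dS_eq_zero {k R : ℝ} (hR : 0 < R) (h : IsFarFlow k R F) {x : R3} (hx : x ≠ 0) :
    dS F (0, x) = 0 := by
  have hc : ∀ {G : ℝ × R3 → ℂ}, ContDiffAt ℝ ∞ G (0, x) →
      Filter.Tendsto (fun s : ℝ => G (s, x)) (𝓝[>] 0) (𝓝 (G (0, x))) := fun hG =>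
    (ContinuousAt.comp (f := fun s : ℝ => (s, x)) hG.continuousAt (by fun_prop)).tendsto.mono_left
      nhdsWithin_le_nhds
  have h0 := h.smooth _ (zero_mem_farDom hx)
  rw [← (h.farGen hR).zero x hx]
  refine tendsto_nhds_unique (hc h0.dS) ((hc (h0.farGen k hx)).congr' ?_)
  have hev : ∀ᶠ s : ℝ in 𝓝 0, (s, x) ∈ farDom R :=
    ContinuousAt.preimage_mem_nhds (f := fun s : ℝ => (s, x)) (by fun_prop)
      ((isOpen_farDom R).mem_nhds (zero_mem_farDom hx))
  filter_upwards [nhdsWithin_le_nhds hev, self_mem_nhdsWithin] with s hs hs0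
  exact (h.flow _ hs hs0).symm

lemma IsFarFlow.exists_bound {k R : ℝ} (hR : 0 < R) {x : R3} (hx : x ≠ 0) (n : ℕ) :
    ∀ {F : ℝ × R3 → ℂ}, IsFarFlow k R F →
      ∃ C > 0, ∃ δ > 0, ∀ s, 0 ≤ s → s < δ → ‖F (s, x)‖ ≤ C * s ^ n := by
  induction n with
  | zero =>
    intro F h
    have hc : ContinuousAt (fun s : ℝ => F (s, x)) 0 :=
      ContinuousAt.comp (f := fun s : ℝ => (s, x)) (h.smooth _ (zero_mem_farDom hx)).continuousAt
        (by fun_prop)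
    obtain ⟨δ, hδ, hb⟩ := Metric.continuousAt_iff.1 hc 1 one_pos
    refine ⟨1, one_pos, δ, hδ, fun s h0 hs => ?_⟩
    have := hb (x := s) (by simpa [abs_of_nonneg h0] using hs)
    rw [h.zero x hx, dist_zero_right] at this
    simpa using this.le
  | succ n ih =>
    intro F h
    obtain ⟨C, hC, δ, hδ, hb⟩ := ih (h.farGen hR)
    have hxn : 0 < ‖x‖ := norm_pos_iff.2 hx
    refine ⟨C, hC, min δ (‖x‖ / (2 * R)), lt_min hδ (by positivity), fun s h0 hs => ?_⟩
    have hmem : ∀ t ∈ Icc 0 s, (t, x) ∈ farDom R := by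
      intro t ht
      have : t < ‖x‖ / (2 * R) := lt_of_le_of_lt ht.2 (hs.trans_le (min_le_right _ _))
      rw [lt_div_iff₀ (by positivity)] at this
      simpa [farDom, abs_of_nonneg ht.1] using this
    have hd : ∀ t ∈ Icc 0 s, HasDerivAt (fun s => F (s, x)) (dS F (t, x)) t := fun t ht =>
      hasDerivAt_dS (q := (t, x)) ((h.smooth _ (hmem t ht)).differentiableAt (by simp))
    have hmv := norm_image_sub_le_of_norm_deriv_le_segment' (f := fun s => F (s, x))
      (f' := fun t => dS F (t, x)) (C := C * s ^ n) (a := 0) (b := s)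
      (fun t ht => (hd t ht).hasDerivWithinAt) ?_ s (right_mem_Icc.2 h0)
    · simp only [h.zero x hx, sub_zero] at hmv
      rw [pow_succ, ← mul_assoc]
      exact hmv
    · intro t ht
      rcases ht.1.eq_or_lt with rfl | htp
      · have hz := h.dS_eq_zero hR hx
        rw [hz, norm_zero]
        positivity
      · rw [h.flow _ (hmem t (Ico_subset_Icc_self ht)) htp]
        refine (hb t ht.1 (ht.2.trans (hs.trans_le (min_le_left _ _)))).trans ?_
        gcongr
        exact ht.2.le

lemma euler_of_homogeneous (h : DifferentiableAt ℝ F q)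
    (hF : ∀ c : ℝ, 0 < c → F (c • q) = (c : ℂ)⁻¹ * F q) :
    q.1 * dS F q + ∑ j, (q.2 j : ℂ) * dX j F q = -F q := by
  have h1 : HasDerivAt (fun c : ℝ => c • q) q 1 := by
    simpa using (hasDerivAt_id (1 : ℝ)).smul_const q
  have h2 : HasDerivAt (fun c : ℝ => F (c • q)) (fderiv ℝ F q q) 1 := by
    have h' : HasFDerivAt F (fderiv ℝ F q) ((1 : ℝ) • q) := by
      rw [one_smul]; exact h.hasFDerivAt
    exact HasFDerivAt.comp_hasDerivAt (f := fun c : ℝ => c • q) 1 h' h1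
  have h3 : HasDerivAt (fun c : ℝ => (c : ℂ)⁻¹ * F q) (-F q) 1 := by
    have := ((hasDerivAt_id (1 : ℝ)).ofReal_comp.inv (by simp)).mul_const (F q)
    simpa using this
  have h4 : (fun c : ℝ => F (c • q)) =ᶠ[𝓝 1] fun c : ℝ => (c : ℂ)⁻¹ * F q := by
    filter_upwards [lt_mem_nhds one_pos] with c hc using hF c hc
  rw [← (h2.congr_of_eventuallyEq h4.symm).unique h3]
  have hq : q = q.1 • ((1 : ℝ), (0 : R3)) + (0, q.2) := by ext <;> simp
  have hx : ((0 : ℝ), q.2) = ∑ j, q.2 j • ((0 : ℝ), EuclideanSpace.single j (1 : ℝ)) := by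
    ext i
    · simp [Prod.fst_sum]
    · simp [Prod.snd_sum, Finset.sum_apply, Pi.single_apply]
  conv_rhs => rw [show fderiv ℝ F q q = fderiv ℝ F q (q.1 • ((1 : ℝ), (0 : R3)) +
    ∑ j, q.2 j • ((0 : ℝ), EuclideanSpace.single j (1 : ℝ))) by rw [← hx, ← hq]]
  simp only [map_add, map_sum, map_smul, dS, dX, Complex.real_smul]

variable {f : R3 → ℂ}

lemma lapX_eq_lap (h : ∀ᶠ p in 𝓝 q, ContDiffAt ℝ ∞ F p) :
    lapX F q = lap (fun x => F (q.1, x)) q.2 := by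
  refine Finset.sum_congr rfl fun j _ => ?_
  rw [dX_eq_pd j ((h.self_of_nhds.dX j).differentiableAt (by simp))]
  refine pd_congr ?_
  have hc : ContinuousAt (fun x : R3 => (q.1, x)) q.2 := by fun_prop
  filter_upwards [hc.eventually h] with x hx
  exact dX_eq_pd j (hx.differentiableAt (by simp))

lemma dS_farField {k R : ℝ} (hk : k ≠ 0) (hR : 0 < R) (hf : ContDiff ℝ 1 f)
    (hsupp : ∀ y, R < ‖y‖ → f y = 0) (hq : q ∈ farDom R) (hs : 0 < q.1) :
    dS (farField k f) q = farGen k (farField k f) q := by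
  have hU := (isOpen_farDom R).mem_nhds hq
  have hsm : ∀ p ∈ farDom R, ContDiffAt ℝ ∞ (farField k f) p := fun p hp =>
    (contDiffOn_farField k hR hf.continuous.locallyIntegrable hsupp).contDiffAt
      ((isOpen_farDom R).mem_nhds hp)
  have hev : ∀ᶠ p in 𝓝 q, ContDiffAt ℝ ∞ (farField k f) p := by
    filter_upwards [hU] with p hp using hsm p hp
  have hfc : HasCompactSupport f :=
    HasCompactSupport.intro (isCompact_closedBall (0 : R3) R) fun y hy =>
      hsupp y (by simpa using hy)
  have hd : DifferentiableAt ℝ (farField k f) q := (hsm q hq).differentiableAt (by simp)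
  have heuler := euler_of_homogeneous hd fun c hc => farField_smul k f hc q
  have hx := ne_zero_of_mem_farDom hR hq
  obtain ⟨s, x⟩ := q
  simp only at *
  set v : R3 → ℂ := fun y => farField k f (s, y) with hv
  set c : ℂ := Complex.I * k / s with hc
  have hsC : (s : ℂ) ≠ 0 := by exact_mod_cast hs.ne'
  have hkC : (k : ℂ) ≠ 0 := by exact_mod_cast hk
  have hrC : ((‖x‖ : ℝ) : ℂ) ≠ 0 := by exact_mod_cast norm_ne_zero_iff.2 hx
  have hvs : ContDiffAt ℝ 2 v x := by
    have h1 : ContDiffAt ℝ 2 (farField k f) (s, x) :=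
      (hsm _ hq).of_le ENat.LEInfty.out
    exact ContDiffAt.comp x (f := fun y : R3 => (s, y)) h1 (by fun_prop)
  have hpot : (fun y => (s : ℂ)⁻¹ * pot k f (s⁻¹ • y)) =ᶠ[𝓝 x] fun y => sphWave c y * v y := by
    have hcx : ContinuousAt (fun y : R3 => (s, y)) x := by fun_prop
    filter_upwards [hcx.preimage_mem_nhds hU] with y hy
    rw [hv]
    simp only
    rw [farField_eq_pot k hR hsupp hy hs, sphWave]
    have he : Complex.exp (c * (‖y‖ : ℝ)) *
        Complex.exp (-(Complex.I * k * (‖y‖ / s : ℝ))) = 1 := by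
      rw [← Complex.exp_add, hc]
      push_cast
      rw [show Complex.I * k / s * ‖y‖ + -(Complex.I * k * (‖y‖ / s)) = 0 by ring, Complex.exp_zero]
    simp only
    linear_combination -((s : ℂ)⁻¹ * pot k f (s⁻¹ • y)) * he
  have hl1 : lap (fun y => (s : ℂ)⁻¹ * pot k f (s⁻¹ • y)) x =
      c ^ 2 * (sphWave c x * v x) := by
    have hp2 : ContDiff ℝ 2 (fun y => pot k f (s⁻¹ • y)) :=
      (contDiff_two_pot k hf hfc).comp (contDiff_const_smul _)
    have := lap_mul (x := x) (contDiffAt_const (c := (s : ℂ)⁻¹)) hp2.contDiffAt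
    have hz : lap (fun _ : R3 => (s : ℂ)⁻¹) x = 0 := by
      simp [lap, pd_const, show ∀ j, pd j (fun _ : R3 => (s : ℂ)⁻¹) = fun _ => 0 from
        fun j => funext fun y => pd_const j _]
    have hf0 : f (s⁻¹ • x) = 0 := by
      apply hsupp
      have h1 : |s| * (2 * R) < ‖x‖ := hq
      rw [norm_smul, Real.norm_of_nonneg (by positivity), inv_mul_eq_div, lt_div_iff₀ hs]
      rw [abs_of_pos hs] at h1
      nlinarith [mul_pos hs hR]
    rw [this, hz, lap_comp_smul, lap_pot k hf hfc, hf0]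
    simp only [pd_const]
    have hp0 : (s : ℂ)⁻¹ * pot k f (s⁻¹ • x) = sphWave c x * v x := hpot.self_of_nhds
    rw [← hp0, hc]
    push_cast
    field_simp
    simp
  have hl2 := hl1
  rw [lap_congr hpot, lap_mul (contDiffAt_sphWave c hx) hvs, lap_sphWave c hx] at hl2
  have hdX : ∀ j, dX j (farField k f) (s, x) = pd j v x := fun j => dX_eq_pd j hd
  have hl : lap v x = -(2 * c / ‖x‖) * (v x + ∑ j, (x j : ℂ) * pd j v x) := by
    have he : sphWave c x ≠ 0 := Complex.exp_ne_zero _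
    have hsum : ∑ j, pd j (sphWave c) x * pd j v x =
        sphWave c x * (c / ‖x‖ * ∑ j, (x j : ℂ) * pd j v x) := by
      simp only [Finset.mul_sum]
      refine Finset.sum_congr rfl fun j _ => ?_
      rw [pd_sphWave c j hx]
      ring
    rw [hsum] at hl2
    refine mul_left_cancel₀ he ?_
    linear_combination hl2
  rw [farGen, lapX_eq_lap hev]
  simp only [hdX] at heuler
  rw [show lap (fun y => farField k f ((s, x).1, y)) (s, x).2 = lap v x from rfl, hl, hc]
  have hI := Complex.I_ne_zero
  have hsum : ∑ j, (x j : ℂ) * pd j v x = -v x - s * dS (farField k f) (s, x) := by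
    linear_combination heuler
  rw [hsum]
  field_simp
  ring

end FarFieldFlow

section Analytic

open Set Metric Filter

lemma differentiableAt_integral_of_holomorphic {β : Type*} [MeasurableSpace β] {μ : Measure β}
    {F : ℂ → β → ℂ} {z₀ : ℂ} {r : ℝ} (hr : 0 < r) {bound : β → ℝ}
    (hmeas : ∀ z ∈ ball z₀ r, AEStronglyMeasurable (F z) μ)
    (hd : ∀ y, DifferentiableOn ℂ (fun z => F z y) (ball z₀ r))
    (hb : ∀ y, ∀ z ∈ ball z₀ r, ‖F z y‖ ≤ bound y) (hint : Integrable bound μ) :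
    DifferentiableAt ℂ (fun z => ∫ y, F z y ∂μ) z₀ := by
  have hz₀ : z₀ ∈ ball z₀ r := mem_ball_self hr
  have hder : ∀ y, ∀ z ∈ ball z₀ (r / 2),
    HasDerivAt (fun z => F z y) (deriv (fun z => F z y) z) z :=
    fun y z hz => ((hd y).differentiableAt
      (isOpen_ball.mem_nhds (ball_subset_ball (by linarith) hz))).hasDerivAt
  have hderb : ∀ y, ∀ z ∈ ball z₀ (r / 2), ‖deriv (fun z => F z y) z‖ ≤ bound y / (r / 4) := by
    intro y z hz
    have hsub : closedBall z (r / 4) ⊆ ball z₀ r := by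
      intro w hw
      rw [mem_ball] at hz ⊢
      rw [mem_closedBall] at hw
      linarith [dist_triangle w z z₀]
    refine Complex.norm_deriv_le_of_forall_mem_sphere_norm_le (by positivity) ?_ fun w hw =>
      hb y w (hsub (sphere_subset_closedBall hw))
    refine DifferentiableOn.diffContOnCl ?_
    rw [closure_ball z (by positivity)]
    exact (hd y).mono hsub
  have hF' : AEStronglyMeasurable (fun y => deriv (fun z => F z y) z₀) μ := by
    set t : ℕ → ℂ := fun n => ((r / 2 / (n + 1) : ℝ) : ℂ) with ht
    have ht0 : ∀ n : ℕ, 0 < r / 2 / ((n : ℝ) + 1) := fun n => by positivity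
    have htend : Tendsto t atTop (𝓝[≠] 0) := by
      rw [tendsto_nhdsWithin_iff]
      constructor
      · have h1 : Tendsto (fun n : ℕ => r / 2 / ((n : ℝ) + 1)) atTop (𝓝 0) :=
          tendsto_const_div_atTop_nhds_zero_nat (r / 2) |>.comp (tendsto_add_atTop_nat 1) |>.congr
            fun n => by simp
        have := (Complex.continuous_ofReal.tendsto 0).comp h1
        rw [Complex.ofReal_zero] at this
        exact this
      · exact .of_forall fun n => by
          simp only [mem_compl_iff, mem_singleton_iff, ht]
          exact_mod_cast (ht0 n).ne'
    refine aestronglyMeasurable_of_tendsto_ae atTop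
      (f := fun n y => (t n)⁻¹ • (F (z₀ + t n) y - F z₀ y)) (fun n => ?_) (.of_forall fun y => ?_)
    · have hmem : z₀ + t n ∈ ball z₀ r := by
        rw [mem_ball, dist_eq_norm, add_sub_cancel_left, Complex.norm_real,
          Real.norm_of_nonneg (ht0 n).le]
        calc r / 2 / ((n : ℝ) + 1) ≤ r / 2 :=
              div_le_self (by positivity) (by linarith [n.cast_nonneg (α := ℝ)])
          _ < r := by linarith
      have hs := (hmeas _ hmem).sub (hmeas _ hz₀)
      exact hs.const_smul (t n)⁻¹
    · have := hasDerivAt_iff_tendsto_slope_zero.1 (hder y z₀ (mem_ball_self (by positivity)))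
      exact this.comp htend
  have hF0 : Integrable (F z₀) μ :=
    hint.mono' (hmeas z₀ hz₀) (.of_forall fun y => hb y z₀ hz₀)
  have := hasDerivAt_integral_of_dominated_loc_of_deriv_le (μ := μ) (F := F)
    (F' := fun z y => deriv (fun z => F z y) z) (x₀ := z₀) (s := ball z₀ (r / 2))
    (bound := fun y => bound y / (r / 4)) (ball_mem_nhds z₀ (by positivity))
    (by filter_upwards [ball_mem_nhds z₀ hr] with z hz using hmeas z hz) hF0 hF'
    (.of_forall fun y z hz => hderb y z hz) (hint.div_const _)
    (.of_forall fun y z hz => hder y z hz)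
  exact this.2.differentiableAt

lemma eqOn_zero_of_holomorphic_of_flat {G : ℂ → ℂ} {δ : ℝ}
    (hG : DifferentiableOn ℂ G (ball 0 δ)) (hδ : 0 < δ)
    (h : ∀ n : ℕ, ∃ C > 0, ∃ ε > 0, ∀ s : ℝ, 0 ≤ s → s < ε → ‖G s‖ ≤ C * s ^ n) :
    ∀ z ∈ ball (0 : ℂ) δ, G z = 0 := by
  have hA : AnalyticOnNhd ℂ G (ball 0 δ) := hG.analyticOnNhd isOpen_ball
  have hA0 := hA 0 (mem_ball_self hδ)
  have hev : ∀ᶠ z in 𝓝 0, G z = 0 := by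
    by_contra hne
    obtain ⟨n, u, hu, hu0, hGu⟩ := hA0.exists_eventuallyEq_pow_smul_nonzero_iff.2 hne
    obtain ⟨C, hC, ε, hε, hb⟩ := h (n + 1)
    have hof : Tendsto (fun s : ℝ => (s : ℂ)) (𝓝[>] 0) (𝓝 0) :=
      (Complex.continuous_ofReal.tendsto' 0 0 (by simp)).mono_left nhdsWithin_le_nhds
    have h1 : Tendsto (fun s : ℝ => ‖u s‖) (𝓝[>] 0) (𝓝 ‖u 0‖) :=
      (hu.continuousAt.tendsto.comp hof).norm
    have h2 : Tendsto (fun s : ℝ => C * s) (𝓝[>] 0) (𝓝 0) :=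
      ((continuous_const.mul continuous_id).tendsto' 0 0 (by simp)).mono_left nhdsWithin_le_nhds
    have h3 : ‖u 0‖ ≤ 0 := by
      refine le_of_tendsto_of_tendsto h1 h2 ?_
      filter_upwards [hof.eventually hGu, self_mem_nhdsWithin,
        nhdsWithin_le_nhds (gt_mem_nhds hε)] with s hs hs0 hsε
      have hs0' : (0 : ℝ) < s := hs0
      have := hb s hs0'.le hsε
      rw [hs, sub_zero, smul_eq_mul, norm_mul, norm_pow, Complex.norm_real,
        Real.norm_of_nonneg hs0'.le, pow_succ] at this
      have hpos : 0 < s ^ n := by positivity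
      refine le_of_mul_le_mul_left ?_ hpos
      linarith
    exact hu0 (norm_le_zero_iff.1 h3)
  exact fun z hz => hA.eqOn_zero_of_preconnected_of_eventuallyEq_zero
    (convex_ball _ _).isPreconnected (mem_ball_self hδ) hev hz

/-- The quadratic `‖x - z y‖² / ‖x‖²` for unit `x`, extended to complex `z`. -/
def farQuad (x y : R3) (z : ℂ) : ℂ := 1 - 2 * z * (inner ℝ x y : ℝ) + z ^ 2 * (‖y‖ ^ 2 : ℝ)

/-- The rescaled outgoing kernel, extended to a complex scaling variable. -/
def farKerC (k : ℝ) (x y : R3) (z : ℂ) : ℂ :=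
  Complex.exp (Complex.I * k * ((-2 * (inner ℝ x y : ℝ) + z * (‖y‖ ^ 2 : ℝ)) /
    (farQuad x y z ^ (2⁻¹ : ℂ) + 1))) / (4 * π * farQuad x y z ^ (2⁻¹ : ℂ))

variable {R : ℝ} {x y : R3} {z : ℂ}

lemma norm_farQuad_sub_one_le (hx : ‖x‖ = 1) (hy : ‖y‖ ≤ R)
    (hz : ‖z‖ * R ≤ 1 / 8) : ‖farQuad x y z - 1‖ ≤ 1 / 2 := by
  have h1 : ‖z‖ * ‖y‖ ≤ 1 / 8 := (mul_le_mul_of_nonneg_left hy (norm_nonneg z)).trans hz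
  have h2 : |inner ℝ x y| ≤ ‖y‖ := by simpa [hx] using abs_real_inner_le_norm x y
  have h0 : 0 ≤ ‖z‖ * ‖y‖ := by positivity
  calc ‖farQuad x y z - 1‖ = ‖-(2 * z * (inner ℝ x y : ℝ)) + z ^ 2 * (‖y‖ ^ 2 : ℝ)‖ := by
        rw [farQuad]; congr 1; ring
    _ ≤ 2 * ‖z‖ * |inner ℝ x y| + ‖z‖ ^ 2 * ‖y‖ ^ 2 := by
        refine (norm_add_le _ _).trans (le_of_eq ?_)
        rw [norm_neg, norm_mul, norm_mul, norm_mul, norm_pow, Complex.norm_real, Complex.norm_real,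
          Real.norm_eq_abs, Real.norm_of_nonneg (by positivity : 0 ≤ ‖y‖ ^ 2)]
        simp
    _ ≤ 2 * (‖z‖ * ‖y‖) + (‖z‖ * ‖y‖) ^ 2 := by
        have := mul_le_mul_of_nonneg_left h2 (norm_nonneg z)
        nlinarith
    _ ≤ 1 / 2 := by nlinarith

lemma half_le_re_farQuad (hx : ‖x‖ = 1) (hy : ‖y‖ ≤ R)
    (hz : ‖z‖ * R ≤ 1 / 8) : 1 / 2 ≤ (farQuad x y z).re := by
  have h1 := (Complex.abs_re_le_norm _).trans (norm_farQuad_sub_one_le hx hy hz)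
  rw [abs_le, Complex.sub_re, Complex.one_re] at h1
  linarith [h1.1]

lemma half_le_re_sqrt_farQuad (hx : ‖x‖ = 1) (hy : ‖y‖ ≤ R)
    (hz : ‖z‖ * R ≤ 1 / 8) : 1 / 2 ≤ (farQuad x y z ^ (2⁻¹ : ℂ)).re := by
  rw [Complex.cpow_inv_two_re]
  apply Real.le_sqrt_of_sq_le
  have h1 := half_le_re_farQuad hx hy hz
  have h2 := Complex.re_le_norm (farQuad x y z)
  linarith

lemma norm_farKerC_le (k : ℝ) (hx : ‖x‖ = 1) (hy : ‖y‖ ≤ R)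
    (hz : ‖z‖ * R ≤ 1 / 8) : ‖farKerC k x y z‖ ≤ Real.exp (|k| * (3 * R)) := by
  have h1 := half_le_re_sqrt_farQuad hx hy hz
  have hR : 0 ≤ R := (norm_nonneg y).trans hy
  set w := farQuad x y z ^ (2⁻¹ : ℂ) with hw
  have h2 : 1 ≤ ‖4 * (π : ℂ) * w‖ := by
    rw [norm_mul, norm_mul, Complex.norm_real, Real.norm_of_nonneg Real.pi_pos.le]
    have := h1.trans (Complex.re_le_norm w)
    have h4 : ‖(4 : ℂ)‖ = 4 := by simp
    rw [h4]
    nlinarith [Real.pi_gt_three]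
  have h3 : 1 ≤ ‖w + 1‖ := by
    have := Complex.re_le_norm (w + 1)
    rw [Complex.add_re, Complex.one_re] at this
    linarith
  have h4 : ‖-2 * ((inner ℝ x y : ℝ) : ℂ) + z * (‖y‖ ^ 2 : ℝ)‖ ≤ 3 * R := by
    have h2 : |inner ℝ x y| ≤ ‖y‖ := by simpa [hx] using abs_real_inner_le_norm x y
    refine (norm_add_le _ _).trans ?_
    rw [norm_mul, norm_mul, Complex.norm_real, Complex.norm_real, Real.norm_eq_abs,
      Real.norm_of_nonneg (by positivity : 0 ≤ ‖y‖ ^ 2)]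
    have h5 : ‖z‖ * ‖y‖ ≤ 1 / 8 := (mul_le_mul_of_nonneg_left hy (norm_nonneg z)).trans hz
    have h6 : ‖(-2 : ℂ)‖ = 2 := by simp
    rw [h6]
    nlinarith [norm_nonneg y]
  rw [farKerC, norm_div]
  refine (div_le_self (norm_nonneg _) h2).trans ((Complex.norm_exp_le_exp_norm _).trans ?_)
  rw [Real.exp_le_exp, norm_mul, norm_mul, Complex.norm_I, one_mul, Complex.norm_real,
    Real.norm_eq_abs, norm_div]
  exact mul_le_mul_of_nonneg_left ((div_le_self (norm_nonneg _) h3).trans h4) (abs_nonneg k)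

lemma differentiableAt_farKerC (k : ℝ) (hx : ‖x‖ = 1) (hy : ‖y‖ ≤ R)
    (hz : ‖z‖ * R ≤ 1 / 8) : DifferentiableAt ℂ (farKerC k x y) z := by
  have h1 := half_le_re_sqrt_farQuad hx hy hz
  have hq : DifferentiableAt ℂ (farQuad x y) z := by unfold farQuad; fun_prop
  have hslit : farQuad x y z ∈ Complex.slitPlane := by
    left
    linarith [half_le_re_farQuad hx hy hz]
  have hs : DifferentiableAt ℂ (fun z => farQuad x y z ^ (2⁻¹ : ℂ)) z :=
    hq.cpow (differentiableAt_const _) hslit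
  have h0 : farQuad x y z ^ (2⁻¹ : ℂ) ≠ 0 := by
    intro h
    rw [h, Complex.zero_re] at h1
    linarith
  have h2 : farQuad x y z ^ (2⁻¹ : ℂ) + 1 ≠ 0 := by
    intro h
    have := congrArg Complex.re h
    rw [Complex.add_re, Complex.one_re, Complex.zero_re] at this
    linarith
  have hpi : (π : ℂ) ≠ 0 := by exact_mod_cast Real.pi_ne_zero
  have hn : DifferentiableAt ℂ
      (fun z : ℂ => -2 * ((inner ℝ x y : ℝ) : ℂ) + z * (‖y‖ ^ 2 : ℝ)) z :=
    (differentiableAt_id.mul_const _).const_add _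
  have hd : DifferentiableAt ℂ (fun z => farQuad x y z ^ (2⁻¹ : ℂ) + 1) z := hs.add_const 1
  have hquot := hn.fun_div hd h2
  exact (hquot.const_mul (I * k)).cexp.fun_div (hs.const_mul (4 * (π : ℂ)))
    (mul_ne_zero (mul_ne_zero (by norm_num) hpi) h0)

lemma farKerC_ofReal (k : ℝ) (hx : ‖x‖ = 1) {s : ℝ} (h : x - s • y ≠ 0) :
    farKerC k x y s = farKer k (s, x) y := by
  have hq : farQuad x y s = ((‖x - s • y‖ : ℝ) : ℂ) ^ 2 := by
    rw [farQuad, ← Complex.ofReal_pow ‖x - s • y‖, norm_sub_sq_real, inner_smul_right, norm_smul,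
      mul_pow, Real.norm_eq_abs, sq_abs, hx]
    push_cast
    ring
  have hs : farQuad x y s ^ (2⁻¹ : ℂ) = ((‖x - s • y‖ : ℝ) : ℂ) := by
    rw [hq, Complex.sq_cpow_two_inv (by simpa using h)]
  rw [farKerC, farKer, hs]
  simp only [hx]
  push_cast
  rfl

lemma measurable_farKerC (k : ℝ) (x : R3) (z : ℂ) : Measurable fun y => farKerC k x y z := by
  unfold farKerC farQuad
  fun_prop

lemma farField_eq_zero_of_isFarFlow {k : ℝ} {f : R3 → ℂ} (hR : 0 < R) (hf : Continuous f)
    (hsupp : ∀ y, R < ‖y‖ → f y = 0) (hflow : IsFarFlow k R (farField k f)) (hx : ‖x‖ = 1)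
    {s : ℝ} (hs0 : 0 ≤ s) (hs : s < 1 / (8 * R)) : farField k f (s, x) = 0 := by
  have hx0 : x ≠ 0 := fun h => by simp [h] at hx
  have hδ : 0 < 1 / (8 * R) := by positivity
  have hzR : ∀ z ∈ ball (0 : ℂ) (1 / (8 * R)), ‖z‖ * R ≤ 1 / 8 := by
    intro z hz
    rw [mem_ball_zero_iff, lt_div_iff₀ (by positivity)] at hz
    linarith
  have hfi : Integrable f := hf.integrable_of_hasCompactSupport
    (HasCompactSupport.intro (isCompact_closedBall (0 : R3) R) fun y hy =>
      hsupp y (by simpa using hy))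
  set G : ℂ → ℂ := fun z => ∫ y, f y * farKerC k x y z with hG
  have hGd : DifferentiableOn ℂ G (ball 0 (1 / (8 * R))) := by
    intro z hz
    obtain ⟨r, hr, hsub⟩ := Metric.isOpen_iff.1 isOpen_ball z hz
    refine (differentiableAt_integral_of_holomorphic hr
      (F := fun z y => f y * farKerC k x y z)
      (bound := fun y => ‖f y‖ * Real.exp (|k| * (3 * R))) (fun z _ => ?_) (fun y w hw => ?_)
      (fun y w hw => ?_) (hfi.norm.mul_const _)).differentiableWithinAt
    · exact (hf.measurable.mul (measurable_farKerC k x z)).aestronglyMeasurable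
    · refine DifferentiableAt.differentiableWithinAt ?_
      by_cases hy : R < ‖y‖
      · simp [hsupp y hy]
      · exact (differentiableAt_farKerC k hx (not_lt.1 hy) (hzR w (hsub hw))).const_mul _
    · by_cases hy : R < ‖y‖
      · simp [hsupp y hy]
      · rw [norm_mul]
        exact mul_le_mul_of_nonneg_left (norm_farKerC_le k hx (not_lt.1 hy) (hzR w (hsub hw)))
          (norm_nonneg _)
  have hGs : ∀ s : ℝ, 0 ≤ s → s < 1 / (8 * R) → G s = farField k f (s, x) := by
    intro s hs0 hs
    have hmem : (s, x) ∈ farDom R := by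
      rw [lt_div_iff₀ (by positivity)] at hs
      simp only [farDom, mem_ofPred_eq, hx, abs_of_nonneg hs0]
      nlinarith
    rw [hG, farField]
    refine integral_congr_ae (.of_forall fun y => ?_)
    by_cases hy : R < ‖y‖
    · simp [hsupp y hy]
    · simp only
      rw [farKerC_ofReal k hx
        (sub_smul_ne_zero_of_mem_farDom hmem (by linarith [not_lt.1 hy]))]
  rw [← hGs s hs0 hs]
  refine eqOn_zero_of_holomorphic_of_flat hGd hδ (fun n => ?_) s
    (by rw [mem_ball_zero_iff, Complex.norm_real, Real.norm_of_nonneg hs0]; exact hs)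
  obtain ⟨C, hC, ε, hε, hb⟩ := hflow.exists_bound hR hx0 n
  refine ⟨C, hC, min ε (1 / (8 * R)), lt_min hε hδ, fun s h0 h1 => ?_⟩
  rw [hGs s h0 (h1.trans_le (min_le_right _ _))]
  exact hb s h0 (h1.trans_le (min_le_left _ _))

/-- A radiating potential whose far field pattern vanishes is compactly supported. -/
lemma hasCompactSupport_pot_of_farField_eq_zero {k : ℝ} (hk : k ≠ 0) {f : R3 → ℂ} (hR : 0 < R)
    (hf : ContDiff ℝ 1 f) (hsupp : ∀ y, R < ‖y‖ → f y = 0)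
    (h : ∀ x : R3, x ≠ 0 → farField k f (0, x) = 0) : HasCompactSupport (pot k f) := by
  have hflow : IsFarFlow k R (farField k f) :=
    { smooth := fun q hq => (contDiffOn_farField k hR hf.continuous.locallyIntegrable
        hsupp).contDiffAt ((isOpen_farDom R).mem_nhds hq)
      zero := h
      flow := fun q hq hs => dS_farField hk hR hf hsupp hq hs }
  refine HasCompactSupport.intro (isCompact_closedBall (0 : R3) (8 * R)) fun X hX => ?_
  have hX' : 8 * R < ‖X‖ := by simpa using hX
  have hXp : 0 < ‖X‖ := by linarith
  have hs : ‖X‖⁻¹ < 1 / (8 * R) := by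
    rw [one_div]
    exact inv_strictAnti₀ (by positivity) hX'
  have hx : ‖(‖X‖⁻¹ • X : R3)‖ = 1 := by
    rw [norm_smul, norm_inv, norm_norm, inv_mul_cancel₀ hXp.ne']
  have h1 := farField_eq_zero_of_isFarFlow hR hf.continuous hsupp hflow hx
    (by positivity) hs
  have hmem : (‖X‖⁻¹, (‖X‖⁻¹ • X : R3)) ∈ farDom R := by
    simp only [farDom, mem_ofPred_eq, hx, abs_of_pos (inv_pos.2 hXp)]
    rw [inv_mul_lt_iff₀ hXp]
    linarith
  rw [farField_eq_pot k hR hsupp hmem (inv_pos.2 hXp)] at h1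
  have h2 : ((‖X‖⁻¹ : ℝ) : ℂ)⁻¹ ≠ 0 := by
    rw [Complex.ofReal_inv, inv_inv]
    exact_mod_cast hXp.ne'
  have h3 := (mul_eq_zero.1 h1).resolve_left (mul_ne_zero h2 (Complex.exp_ne_zero _))
  simpa [smul_smul, mul_inv_cancel₀ hXp.ne'] using h3

end Analytic

section Flux

open Set Metric Filter

lemma exists_cutoff : ∃ b : ℝ → ℝ, ContDiff ℝ 2 b ∧ (∀ t, 0 ≤ b t) ∧ (∀ t, 2 ≤ t → b t = 0) ∧
    (∀ t, t < 1 → deriv b t = 0) ∧ (∀ t, 2 < t → deriv b t = 0) ∧ (∀ t, deriv b t ≤ 0) ∧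
    ∃ t, 0 < t ∧ deriv b t ≠ 0 := by
  have hb : ContDiff ℝ 2 fun t : ℝ => Real.smoothTransition (2 - t) :=
    (Real.smoothTransition.contDiff (n := 2)).comp (contDiff_const.sub contDiff_id)
  refine ⟨fun t => Real.smoothTransition (2 - t), hb, fun t => Real.smoothTransition.nonneg _,
    fun t ht => Real.smoothTransition.zero_of_nonpos (by linarith), fun t ht => ?_, fun t ht => ?_,
    fun t => ?_, ?_⟩
  · have : (fun t : ℝ => Real.smoothTransition (2 - t)) =ᶠ[𝓝 t] fun _ => 1 := by
      filter_upwards [Iio_mem_nhds ht] with u hu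
      exact Real.smoothTransition.one_of_one_le (by rw [mem_Iio] at hu; linarith)
    rw [this.deriv_eq, deriv_const]
  · have : (fun t : ℝ => Real.smoothTransition (2 - t)) =ᶠ[𝓝 t] fun _ => 0 := by
      filter_upwards [Ioi_mem_nhds ht] with u hu
      exact Real.smoothTransition.zero_of_nonpos (by rw [mem_Ioi] at hu; linarith)
    rw [this.deriv_eq, deriv_const]
  · refine Antitone.deriv_nonpos fun u v huv => Real.smoothTransition.monotone ?_
    linarith
  · obtain ⟨t, ht, hs⟩ := exists_deriv_eq_slope (fun t : ℝ => Real.smoothTransition (2 - t))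
      (by norm_num : (1 : ℝ) < 2) hb.continuous.continuousOn
      (hb.differentiable (by norm_num)).differentiableOn
    refine ⟨t, by linarith [ht.1], ?_⟩
    rw [hs]
    have h1 : Real.smoothTransition (2 - 1) = 1 := Real.smoothTransition.one_of_one_le (by norm_num)
    have h2 : Real.smoothTransition (2 - 2) = 0 :=
      Real.smoothTransition.zero_of_nonpos (by norm_num)
    norm_num [h1, h2]

lemma pd_radial {b : ℝ → ℝ} (hb : Differentiable ℝ b) (s : ℝ) (j : Fin 3) (x : R3) :
    pd j (fun y => ((b (s ^ 2 * ‖y‖ ^ 2) : ℝ) : ℂ)) x =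
      ((2 * s ^ 2 * deriv b (s ^ 2 * ‖x‖ ^ 2) * x j : ℝ) : ℂ) := by
  have h1 := ((hasStrictFDerivAt_norm_sq x).hasFDerivAt.const_mul (s ^ 2))
  have h2 := (hb (s ^ 2 * ‖x‖ ^ 2)).hasDerivAt.comp_hasFDerivAt x h1
  have h3 := Complex.ofRealCLM.hasFDerivAt.comp x h2
  have h4 : fderiv ℝ (fun y : R3 => ((b (s ^ 2 * ‖y‖ ^ 2) : ℝ) : ℂ)) x = _ := h3.fderiv
  rw [pd, h4]
  simp [EuclideanSpace.inner_single_right]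
  ring

lemma integral_flux_eq {χ ψ : R3 → ℂ} (hχ : ContDiff ℝ 1 χ) (hc : HasCompactSupport χ)
    (hψ : ContDiff ℝ 2 ψ) :
    ∫ x, ∑ j, pd j χ x * (conj (ψ x) * pd j ψ x - ψ x * conj (pd j ψ x)) =
      -∫ x, χ x * (conj (ψ x) * lap ψ x - ψ x * conj (lap ψ x)) := by
  have hψ1 : ContDiff ℝ 1 ψ := hψ.of_le (by norm_num)
  have hpd : ∀ j, ContDiff ℝ 1 (pd j ψ) := fun j => hψ.pd (by norm_num) j
  set W : Fin 3 → R3 → ℂ := fun j x => conj (ψ x) * pd j ψ x - ψ x * conj (pd j ψ x) with hW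
  have hW1 : ∀ j, ContDiff ℝ 1 (W j) := fun j =>
    ((contDiff_conj hψ1).mul (hpd j)).sub (hψ1.mul (contDiff_conj (hpd j)))
  have hdW : ∀ j x, pd j (W j) x =
      conj (ψ x) * pd j (pd j ψ) x - ψ x * conj (pd j (pd j ψ) x) := by
    intro j x
    have d1 : DifferentiableAt ℝ ψ x := hψ1.differentiable (by norm_num) x
    have d2 : DifferentiableAt ℝ (pd j ψ) x := (hpd j).differentiable (by norm_num) x
    have d3 : DifferentiableAt ℝ (fun y => conj (ψ y)) x :=
      (contDiff_conj hψ1).differentiable (by norm_num) x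
    have d4 : DifferentiableAt ℝ (fun y => conj (pd j ψ y)) x :=
      (contDiff_conj (hpd j)).differentiable (by norm_num) x
    rw [hW]
    simp only
    rw [pd_sub j (d3.fun_mul d2) (d1.fun_mul d4), pd_mul j d3 d2, pd_mul j d1 d4, pd_conj, pd_conj]
    ring
  have hz : ∀ j, ∫ x, pd j (fun y => χ y * W j y) x = 0 := fun j =>
    integral_pd_eq_zero (hχ.mul (hW1 j)) hc.mul_right j
  have hprod : ∀ j x, pd j (fun y => χ y * W j y) x = pd j χ x * W j x + χ x * pd j (W j) x :=
    fun j x => pd_mul j (hχ.differentiable (by norm_num) x) ((hW1 j).differentiable (by norm_num) x)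
  have hi1 : ∀ j, Integrable fun x => pd j χ x * W j x := fun j =>
    ((hχ.continuous_pd j).mul (hW1 j).continuous).integrable_of_hasCompactSupport
      (hc.pd j).mul_right
  have hi2 : ∀ j, Integrable fun x => χ x * pd j (W j) x := fun j =>
    (hχ.continuous.mul ((hW1 j).continuous_pd j)).integrable_of_hasCompactSupport hc.mul_right
  have hj : ∀ j, ∫ x, pd j χ x * W j x = -∫ x, χ x * pd j (W j) x := by
    intro j
    have := hz j
    simp only [hprod] at this
    rw [integral_add (hi1 j) (hi2 j)] at this
    exact eq_neg_of_add_eq_zero_left this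
  rw [integral_finsetSum _ fun j _ => hi1 j, Finset.sum_congr rfl fun j _ => hj j,
    Finset.sum_neg_distrib, ← integral_finsetSum _ fun j _ => hi2 j]
  congr 2
  ext x
  simp only [hdW, lap, map_sum, Finset.mul_sum, Finset.sum_sub_distrib, mul_sub]

lemma integral_deriv_cutoff_mul_im_nonneg {b : ℝ → ℝ} (hb : ContDiff ℝ 2 b) (hb0 : ∀ t, 0 ≤ b t)
    (hb2 : ∀ t, 2 ≤ t → b t = 0) {ψ V : R3 → ℂ} (hψ : ContDiff ℝ 2 ψ)
    (heq : ∀ x, lap ψ x = -V x * ψ x) (hV : ∀ x, 0 ≤ (V x).im) {s : ℝ} (hs : 0 < s) :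
    0 ≤ ∫ x, deriv b (s ^ 2 * ‖x‖ ^ 2) * (conj (ψ x) * fderiv ℝ ψ x x).im := by
  set χ : R3 → ℂ := fun y => ((b (s ^ 2 * ‖y‖ ^ 2) : ℝ) : ℂ) with hχdef
  have hχ : ContDiff ℝ 1 χ := by
    have h1 : ContDiff ℝ 1 fun y : R3 => s ^ 2 * ‖y‖ ^ 2 := contDiff_const.mul (contDiff_norm_sq ℝ)
    exact Complex.ofRealCLM.contDiff.comp ((hb.of_le (by norm_num)).comp h1)
  have hc : HasCompactSupport χ := by
    refine HasCompactSupport.intro (isCompact_closedBall 0 (2 / s)) fun x hx => ?_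
    rw [mem_closedBall_zero_iff, not_le, div_lt_iff₀ hs] at hx
    simp only [hχdef]
    rw [hb2 _ (by nlinarith [norm_nonneg x]), Complex.ofReal_zero]
  have key := integral_flux_eq hχ hc hψ
  have hL : ∀ x, ∑ j, pd j χ x * (conj (ψ x) * pd j ψ x - ψ x * conj (pd j ψ x)) =
      ((4 * s ^ 2 * (deriv b (s ^ 2 * ‖x‖ ^ 2) *
        (conj (ψ x) * fderiv ℝ ψ x x).im) : ℝ) : ℂ) * I := by
    intro x
    have h1 := Complex.sub_conj (conj (ψ x) * fderiv ℝ ψ x x)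
    have h2 : ∑ j, pd j χ x * (conj (ψ x) * pd j ψ x - ψ x * conj (pd j ψ x)) =
        ((2 * s ^ 2 * deriv b (s ^ 2 * ‖x‖ ^ 2) : ℝ) : ℂ) *
        (conj (ψ x) * fderiv ℝ ψ x x - conj (conj (ψ x) * fderiv ℝ ψ x x)) := by
      rw [fderiv_eq_sum_pd]
      simp only [hχdef, pd_radial (hb.differentiable (by norm_num)), map_mul, map_sum,
        Complex.conj_conj, Complex.conj_ofReal, Finset.mul_sum, ← Finset.sum_sub_distrib]
      refine Finset.sum_congr rfl fun j _ => ?_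
      push_cast
      ring
    rw [h2, h1]
    push_cast
    ring
  have hRr : ∀ x, χ x * (conj (ψ x) * lap ψ x - ψ x * conj (lap ψ x)) =
      -(((2 * (b (s ^ 2 * ‖x‖ ^ 2) * (V x).im * Complex.normSq (ψ x)) : ℝ) : ℂ) * I) := by
    intro x
    have h1 := Complex.sub_conj (V x)
    have h2 := Complex.mul_conj (ψ x)
    rw [heq, map_mul, map_neg]
    have : χ x * (conj (ψ x) * (-V x * ψ x) - ψ x * (-conj (V x) * conj (ψ x))) =
      -(χ x * (V x - conj (V x)) * (ψ x * conj (ψ x))) := by ring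
    rw [this, h1, h2, hχdef]
    push_cast
    ring
  simp only [hL, hRr] at key
  rw [integral_neg, neg_neg, integral_mul_const, integral_mul_const, integral_complex_ofReal,
    integral_complex_ofReal] at key
  have key2 := mul_right_cancel₀ Complex.I_ne_zero key
  rw [Complex.ofReal_inj, integral_const_mul] at key2
  have hpos : 0 ≤ ∫ x, 2 * (b (s ^ 2 * ‖x‖ ^ 2) * (V x).im * Complex.normSq (ψ x)) :=
    integral_nonneg fun x => mul_nonneg zero_le_two
      (mul_nonneg (mul_nonneg (hb0 _) (hV x)) (Complex.normSq_nonneg _))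
  rw [← key2] at hpos
  exact nonneg_of_mul_nonneg_right hpos (by positivity)

lemma im_conj_pot_mul_fderiv {k R : ℝ} {f : R3 → ℂ} (hR : 0 < R) (hf : ContDiff ℝ 1 f)
    (hc : HasCompactSupport f) (hsupp : ∀ y, R < ‖y‖ → f y = 0) {s : ℝ} (hs : 0 < s) {x : R3}
    (hx : (s, x) ∈ farDom R) :
    (conj (pot k f (s⁻¹ • x)) * fderiv ℝ (pot k f) (s⁻¹ • x) (s⁻¹ • x)).im =
      s * (k * ‖x‖ * Complex.normSq (farField k f (s, x)) +
        s * (conj (farField k f (s, x)) * fderiv ℝ (farField k f) (s, x) (0, x)).im) := by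
  set F := farField k f with hF
  set ψ := pot k f with hψ
  have hsC : (s : ℂ) ≠ 0 := by exact_mod_cast hs.ne'
  have hdF : DifferentiableAt ℝ F (s, x) :=
    ((contDiffOn_farField k hR hf.continuous.locallyIntegrable hsupp).contDiffAt
      ((isOpen_farDom R).mem_nhds hx)).differentiableAt (by simp)
  have hline : HasDerivAt (fun r : ℝ => ((s, r • x) : ℝ × R3)) (0, x) 1 := by
    have h1 := (hasDerivAt_id (1 : ℝ)).smul_const x
    rw [one_smul] at h1
    exact (hasDerivAt_const (1 : ℝ) s).prodMk h1
  have hdF1 : HasDerivAt (fun r : ℝ => F (s, r • x)) (fderiv ℝ F (s, x) (0, x)) 1 := by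
    have h2 : HasFDerivAt F (fderiv ℝ F (s, x)) (s, (1 : ℝ) • x) := by
      rw [one_smul]
      exact hdF.hasFDerivAt
    exact h2.comp_hasDerivAt (1 : ℝ) hline
  have hdψ : HasDerivAt (fun r : ℝ => ψ (r • (s⁻¹ • x))) (fderiv ℝ ψ (s⁻¹ • x) (s⁻¹ • x)) 1 := by
    have h1 := (hasDerivAt_id (1 : ℝ)).smul_const (s⁻¹ • x)
    rw [one_smul] at h1
    have h2 : HasFDerivAt ψ (fderiv ℝ ψ (s⁻¹ • x)) ((1 : ℝ) • (s⁻¹ • x)) := by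
      rw [one_smul]
      exact ((contDiff_two_pot k hf hc).differentiable (by norm_num) _).hasFDerivAt
    exact h2.comp_hasDerivAt (1 : ℝ) h1
  have hrel : ∀ q ∈ farDom R, 0 < q.1 → ψ (q.1⁻¹ • q.2) =
      q.1 * Complex.exp (I * k * ((‖q.2‖ / q.1 : ℝ) : ℂ)) * F q := by
    intro q hq hq0
    have hq1 : (q.1 : ℂ) ≠ 0 := by exact_mod_cast hq0.ne'
    rw [hF, farField_eq_pot k hR hsupp hq hq0, Complex.exp_neg]
    have := Complex.exp_ne_zero (I * k * ((‖q.2‖ / q.1 : ℝ) : ℂ))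
    rw [← mul_assoc, ← mul_assoc, mul_right_comm (q.1 : ℂ), mul_inv_cancel₀ hq1, one_mul,
      mul_inv_cancel₀ this, one_mul]
  have hev : (fun r : ℝ => ψ (r • (s⁻¹ • x))) =ᶠ[𝓝 1] fun r : ℝ =>
      s * Complex.exp (I * k * ((‖x‖ / s : ℝ) : ℂ) * r) * F (s, r • x) := by
    have h1 : ∀ᶠ r : ℝ in 𝓝 1, (s, r • x) ∈ farDom R := by
      refine hline.continuousAt.eventually ((isOpen_farDom R).mem_nhds ?_)
      simpa using hx
    filter_upwards [h1, Ioi_mem_nhds zero_lt_one] with r hr hr0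
    have := hrel _ hr hs
    simp only at this
    rw [smul_comm, this, norm_smul, Real.norm_of_nonneg (le_of_lt hr0)]
    congr 3
    push_cast
    ring
  have hexp : HasDerivAt (fun r : ℝ => (s : ℂ) * Complex.exp (I * k * ((‖x‖ / s : ℝ) : ℂ) * r))
      (s * (Complex.exp (I * k * ((‖x‖ / s : ℝ) : ℂ)) * (I * k * ((‖x‖ / s : ℝ) : ℂ)))) 1 := by
    have h1 := ((Complex.ofRealCLM.hasDerivAt (x := (1 : ℝ))).const_mul
      (I * k * ((‖x‖ / s : ℝ) : ℂ))).cexp.const_mul (s : ℂ)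
    simpa using h1
  have hder := (hdψ.congr_of_eventuallyEq hev.symm).unique (hexp.fun_mul hdF1)
  have hval := hrel _ hx hs
  simp only [Complex.ofReal_one, mul_one, one_smul] at hder hval
  set e := Complex.exp (I * k * ((‖x‖ / s : ℝ) : ℂ)) with he
  have hee : conj e * e = 1 := by
    rw [← Complex.normSq_eq_conj_mul_self, Complex.normSq_eq_norm_sq]
    have : I * k * ((‖x‖ / s : ℝ) : ℂ) = ((k * (‖x‖ / s) : ℝ) : ℂ) * I := by push_cast; ring
    rw [he, this, Complex.norm_exp_ofReal_mul_I]
    simp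
  rw [hder, hval, map_mul, map_mul, Complex.conj_ofReal]
  have hns := Complex.normSq_eq_conj_mul_self (z := F (s, x))
  have : (s : ℂ) * conj e * conj (F (s, x)) * (s * (e * (I * k * ((‖x‖ / s : ℝ) : ℂ))) * F (s, x) +
      s * e * fderiv ℝ F (s, x) (0, x)) =
      (conj e * e) * (((s * (k * ‖x‖ * Complex.normSq (F (s, x))) : ℝ) : ℂ) * I +
        ((s ^ 2 : ℝ) : ℂ) * (conj (F (s, x)) * fderiv ℝ F (s, x) (0, x))) := by
    push_cast
    rw [hns]
    field_simp
  rw [this, hee, one_mul, Complex.add_im, Complex.mul_I_im, Complex.ofReal_re,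
    Complex.im_ofReal_mul]
  ring

lemma farField_zero_eq_zero {k R : ℝ} (hk : 0 < k) (hR : 0 < R) {p f : R3 → ℂ}
    (hf : ContDiff ℝ 1 f) (hc : HasCompactSupport f) (hsupp : ∀ y, R < ‖y‖ → f y = 0)
    (hfp : ∀ x, f x = p x * pot k f x) (hp : ∀ x, 0 ≤ (p x).im) {x : R3} (hx : x ≠ 0) :
    farField k f (0, x) = 0 := by
  obtain ⟨b, hb, hb0, hb2, hd1, hd2, hdn, t, ht0, htd⟩ := exists_cutoff
  have hdb : Continuous (deriv b) := hb.continuous_deriv (by norm_num)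
  set F := farField k f with hF
  have hFs : ∀ q ∈ farDom R, ContDiffAt ℝ 1 F q := fun q hq =>
    ((contDiffOn_farField k hR hf.continuous.locallyIntegrable hsupp).contDiffAt
      ((isOpen_farDom R).mem_nhds hq)).of_le (by exact_mod_cast le_top)
  set s₀ : ℝ := 1 / (4 * R) with hs₀
  have hs₀pos : 0 < s₀ := by positivity
  have hdom : ∀ s ∈ Ico 0 s₀, ∀ y : R3, 1 ≤ ‖y‖ → (s, y) ∈ farDom R := by
    intro s hs y hy
    have h1 : s * (4 * R) < 1 := (lt_div_iff₀ (by positivity)).1 hs.2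
    rw [farDom, Set.mem_ofPred_eq]
    simp only [abs_of_nonneg hs.1]
    linarith
  set G : ℝ → R3 → ℝ := fun s y => deriv b (‖y‖ ^ 2) * (k * ‖y‖ * Complex.normSq (F (s, y)) +
    s * (conj (F (s, y)) * fderiv ℝ F (s, y) (0, y)).im) with hG
  have hG0 : ∀ s y, ‖y‖ < 1 → G s y = 0 := fun s y hy => by
    simp only [hG]
    rw [hd1 _ (by nlinarith [norm_nonneg y]), zero_mul]
  have hG2 : ∀ s y, y ∉ closedBall (0 : R3) 2 → G s y = 0 := fun s y hy => by
    rw [mem_closedBall_zero_iff, not_le] at hy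
    simp only [hG]
    rw [hd2 _ (by nlinarith), zero_mul]
  have hGc : ContinuousOn (Function.uncurry G) (Ico 0 s₀ ×ˢ univ) := by
    rintro ⟨s, y⟩ ⟨hs, -⟩
    refine ContinuousAt.continuousWithinAt ?_
    by_cases hy : ‖y‖ < 1
    · have : Function.uncurry G =ᶠ[𝓝 (s, y)] fun _ => 0 := by
        have hopen : IsOpen {q : ℝ × R3 | ‖q.2‖ < 1} :=
          isOpen_lt continuous_snd.norm continuous_const
        filter_upwards [hopen.mem_nhds hy] with q hq using hG0 q.1 q.2 hq
      exact continuousAt_const.congr this.symm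
    · have h1 := hFs _ (hdom s hs y (not_lt.1 hy))
      have h2 : ContinuousAt (fun q : ℝ × R3 => F (q.1, q.2)) (s, y) := h1.continuousAt
      have h3 : ContinuousAt (fun q : ℝ × R3 => fderiv ℝ F (q.1, q.2)) (s, y) :=
        (h1.fderiv_right (m := 0) (by simp)).continuousAt
      have h4 : ContinuousAt (fun q : ℝ × R3 => fderiv ℝ F (q.1, q.2) (0, q.2)) (s, y) :=
        h3.clm_apply (by fun_prop)
      have h5 : ContinuousAt (fun q : ℝ × R3 => conj (F (q.1, q.2))) (s, y) :=
        Complex.continuous_conj.continuousAt.comp h2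
      have h6 : ContinuousAt (fun q : ℝ × R3 =>
          (conj (F (q.1, q.2)) * fderiv ℝ F (q.1, q.2) (0, q.2)).im) (s, y) :=
        Complex.continuous_im.continuousAt.comp (h5.mul h4)
      have h7 : ContinuousAt (fun q : ℝ × R3 => Complex.normSq (F (q.1, q.2))) (s, y) :=
        Complex.continuous_normSq.continuousAt.comp h2
      have h8 : ContinuousAt (fun q : ℝ × R3 => deriv b (‖q.2‖ ^ 2)) (s, y) :=
        (hdb.comp (continuous_snd.norm.pow 2)).continuousAt
      have h9 : ContinuousAt (fun q : ℝ × R3 => k * ‖q.2‖) (s, y) := by fun_prop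
      exact h8.mul ((h9.mul h7).add (continuousAt_fst.mul h6))
  have hint : ContinuousOn (fun s => ∫ y, G s y) (Ico 0 s₀) :=
    continuousOn_integral_of_compact_support (isCompact_closedBall (0 : R3) 2) hGc
      fun s y _ hy => hG2 s y hy
  have hpos : ∀ s ∈ Ioo 0 s₀, 0 ≤ ∫ y, G s y := by
    intro s hs
    have h1 := integral_deriv_cutoff_mul_im_nonneg hb hb0 hb2 (contDiff_two_pot k hf hc)
      (V := fun x => (k : ℂ) ^ 2 + p x) (fun x => by rw [lap_pot k hf hc, hfp x]; ring)
      (fun x => by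
        rw [Complex.add_im, ← Complex.ofReal_pow, Complex.ofReal_im, zero_add]
        exact hp x) hs.1
    have h2 := Measure.integral_comp_inv_smul (volume : Measure R3) (fun x =>
      deriv b (s ^ 2 * ‖x‖ ^ 2) * (conj (pot k f x) * fderiv ℝ (pot k f) x x).im) s
    have h3 : ∀ x : R3, deriv b (s ^ 2 * ‖s⁻¹ • x‖ ^ 2) *
        (conj (pot k f (s⁻¹ • x)) * fderiv ℝ (pot k f) (s⁻¹ • x) (s⁻¹ • x)).im = s * G s x := by
      intro x
      have h4 : s ^ 2 * ‖s⁻¹ • x‖ ^ 2 = ‖x‖ ^ 2 := by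
        rw [norm_smul, norm_inv, Real.norm_of_nonneg hs.1.le, ← mul_pow,
          mul_inv_cancel_left₀ hs.1.ne']
      rw [h4]
      by_cases hy : ‖x‖ < 1
      · rw [hG0 s x hy, hd1 _ (by nlinarith [norm_nonneg x])]
        simp
      · rw [im_conj_pot_mul_fderiv hR hf hc hsupp hs.1 (hdom s ⟨hs.1.le, hs.2⟩ x (not_lt.1 hy))]
        simp only [hG, hF]
        ring
    simp only [h3] at h2
    rw [integral_const_mul] at h2
    refine nonneg_of_mul_nonneg_right (h2.symm ▸ ?_ : 0 ≤ s * ∫ y, G s y) hs.1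
    exact smul_nonneg (abs_nonneg _) h1
  have hlim : 0 ≤ ∫ y, G 0 y := by
    have h1 : Tendsto (fun s => ∫ y, G s y) (𝓝[Ioo 0 s₀] 0) (𝓝 (∫ y, G 0 y)) :=
      (hint 0 ⟨le_rfl, hs₀pos⟩).mono_left (nhdsWithin_mono _ Ioo_subset_Ico_self)
    rw [nhdsWithin_Ioo_eq_nhdsGT hs₀pos] at h1
    refine ge_of_tendsto h1 ?_
    filter_upwards [Ioo_mem_nhdsGT hs₀pos] with s hs using hpos s hs
  have hGle : ∀ y, 0 ≤ -G 0 y := by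
    intro y
    simp only [hG, zero_mul, add_zero]
    have := hdn (‖y‖ ^ 2)
    have h2 : 0 ≤ k * ‖y‖ * Complex.normSq (F (0, y)) :=
      mul_nonneg (by positivity) (Complex.normSq_nonneg _)
    nlinarith
  have hGc0 : Continuous fun y => -G 0 y := by
    have h1 : ContinuousOn (fun y => Function.uncurry G (0, y)) univ :=
      hGc.comp (by fun_prop) fun y _ => ⟨⟨le_rfl, hs₀pos⟩, mem_univ _⟩
    exact (continuousOn_univ.1 h1).neg
  have hGz : ∀ y, G 0 y = 0 := by
    intro y
    by_contra hne
    have := hGc0.integral_pos_of_hasCompactSupport_nonneg_nonzero (μ := volume)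
      (HasCompactSupport.intro (isCompact_closedBall (0 : R3) 2) fun y hy => by
        rw [hG2 0 y hy, neg_zero]) hGle (x := y) (neg_ne_zero.2 hne)
    rw [integral_neg] at this
    linarith
  have hxn : 0 < ‖x‖ := norm_pos_iff.2 hx
  set c : ℝ := √t / ‖x‖ with hcdef
  have hc0 : 0 < c := by positivity
  have hcx : ‖c • x‖ = √t := by
    rw [norm_smul, Real.norm_of_nonneg hc0.le, hcdef, div_mul_cancel₀ _ hxn.ne']
  have h1 := hGz (c • x)
  simp only [hG, zero_mul, add_zero, hcx, Real.sq_sqrt ht0.le, mul_eq_zero, htd, hk.ne',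
    (Real.sqrt_pos.2 ht0).ne', false_or, Complex.normSq_eq_zero] at h1
  have h2 := farField_smul k f hc0 (0, x)
  rw [Prod.smul_mk, smul_zero, ← hF, h1] at h2
  have hcC : ((c : ℂ))⁻¹ ≠ 0 := inv_ne_zero (by exact_mod_cast hc0.ne')
  exact (mul_eq_zero.1 h2.symm).resolve_left hcC

end Flux

section Carleman

open Set Metric Filter

variable {u v : R3 → ℂ}

lemma integrable_norm_sq (hu : Continuous u) (hc : HasCompactSupport u) :
    Integrable fun x => ‖u x‖ ^ 2 :=
  Continuous.integrable_of_hasCompactSupport (hu.norm.pow 2)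
    (hc.comp_left (g := fun z : ℂ => ‖z‖ ^ 2) (by simp))

lemma integral_mul_pd (hu : ContDiff ℝ 1 u) (hv : ContDiff ℝ 1 v) (hc : HasCompactSupport u)
    (i : Fin 3) : ∫ x, u x * pd i v x = -∫ x, pd i u x * v x := by
  have h := integral_pd_eq_zero (hu.mul hv) hc.mul_right i
  have hd : ∀ x, pd i (fun y => u y * v y) x = pd i u x * v x + u x * pd i v x := fun x =>
    pd_mul i (hu.differentiable (by norm_num) x) (hv.differentiable (by norm_num) x)
  simp only [hd] at h
  have hi1 : Integrable fun x => pd i u x * v x :=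
    ((hu.continuous_pd i).mul hv.continuous).integrable_of_hasCompactSupport (hc.pd i).mul_right
  have hi2 : Integrable fun x => u x * pd i v x :=
    (hu.continuous.mul (hv.continuous_pd i)).integrable_of_hasCompactSupport hc.mul_right
  rw [integral_add hi1 hi2] at h
  exact eq_neg_of_add_eq_zero_right h

lemma re_integral_mul_conj_pd (hu : ContDiff ℝ 1 u) (hc : HasCompactSupport u) (i : Fin 3) :
    (∫ x, u x * conj (pd i u x)).re = 0 := by
  have h := integral_mul_pd hu (contDiff_conj hu) hc i
  have h2 : ∫ x, pd i u x * conj (u x) = conj (∫ x, u x * conj (pd i u x)) := by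
    rw [← integral_conj]
    congr 1 with x
    rw [map_mul, Complex.conj_conj, mul_comm]
  simp only [pd_conj] at h
  rw [h2] at h
  have := congrArg Complex.re h
  rw [Complex.neg_re, Complex.conj_re] at this
  linarith

lemma re_integral_lap_mul_conj_pd (hu : ContDiff ℝ 2 u) (hc : HasCompactSupport u) (i : Fin 3) :
    (∫ x, lap u x * conj (pd i u x)).re = 0 := by
  have hpd : ∀ j, ContDiff ℝ 1 (pd j u) := fun j => hu.pd (by norm_num) j
  have hj : ∀ j, (∫ x, pd j (pd j u) x * conj (pd i u x)).re = 0 := by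
    intro j
    have h1 := integral_mul_pd (hpd j) (contDiff_conj (hpd i)) (hc.pd j) j
    have h2 := re_integral_mul_conj_pd (hpd j) (hc.pd j) i
    simp only [pd_conj] at h1
    have h3 : ∀ x, pd j (pd i u) x = pd i (pd j u) x := fun x => pd_comm hu.contDiffAt j i
    simp only [h3] at h1
    rw [h1, Complex.neg_re] at h2
    exact neg_eq_zero.1 h2
  have hint : ∀ j, Integrable fun x => pd j (pd j u) x * conj (pd i u x) := fun j =>
    (((hpd j).continuous_pd j).mul (contDiff_conj (hpd i)).continuous
      ).integrable_of_hasCompactSupport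
      ((hc.pd j).pd j).mul_right
  simp only [lap, Finset.sum_mul]
  rw [integral_finsetSum _ fun j _ => hint j, Complex.re_sum]
  exact Finset.sum_eq_zero fun j _ => hj j

lemma integral_norm_sq_le (hu : ContDiff ℝ 1 u) {R : ℝ}
    (hsupp : ∀ x, R < ‖x‖ → u x = 0) (i : Fin 3) :
    ∫ x, ‖u x‖ ^ 2 ≤ 4 * R ^ 2 * ∫ x, ‖pd i u x‖ ^ 2 := by
  have hc : HasCompactSupport u := HasCompactSupport.intro (isCompact_closedBall 0 R) fun x hx =>
    hsupp x (by simpa using hx)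
  have h1 := integral_mul_pd (u := fun x => ((x i : ℝ) : ℂ) * u x)
    ((contDiff_coord i).mul hu) (contDiff_conj hu) hc.mul_left i
  have hcoord : ContDiff ℝ 1 fun x : R3 => ((x i : ℝ) : ℂ) := contDiff_coord i
  have hd : ∀ x, pd i (fun y => ((y i : ℝ) : ℂ) * u y) x = u x + x i * pd i u x := fun x => by
    rw [pd_mul i (hcoord.differentiable (by norm_num) x) (hu.differentiable (by norm_num) x),
      pd_coord, if_pos rfl, one_mul]
  simp only [hd, pd_conj] at h1
  have hi1 : Integrable fun x => u x * conj (u x) :=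
    (hu.continuous.mul (contDiff_conj hu).continuous).integrable_of_hasCompactSupport hc.mul_right
  have hi2 : Integrable fun x => (x i : ℂ) * pd i u x * conj (u x) :=
    ((hcoord.continuous.mul (hu.continuous_pd i)).mul
      (contDiff_conj hu).continuous).integrable_of_hasCompactSupport (hc.pd i).mul_left.mul_right
  have hi3 : Integrable fun x => (x i : ℂ) * u x * conj (pd i u x) :=
    ((hcoord.continuous.mul hu.continuous).mul (Complex.continuous_conj.comp
      (hu.continuous_pd i))).integrable_of_hasCompactSupport hc.mul_left.mul_right
  have hin := integrable_norm_sq hu.continuous hc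
  have hid := integrable_norm_sq (hu.continuous_pd i) (hc.pd i)
  have h2 : ∫ x, u x * conj (u x) = ((∫ x, ‖u x‖ ^ 2 : ℝ) : ℂ) := by
    rw [← integral_complex_ofReal]
    congr 1 with x
    rw [Complex.mul_conj, Complex.normSq_eq_norm_sq]
  simp only [add_mul] at h1
  rw [integral_add hi1 hi2, h2] at h1
  have h3 : ((∫ x, ‖u x‖ ^ 2 : ℝ) : ℂ) =
      -∫ x, ((x i : ℂ) * u x * conj (pd i u x) + (x i : ℂ) * pd i u x * conj (u x)) := by
    rw [integral_add hi3 hi2, h1]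
    ring
  have h4 : ∫ x, ‖u x‖ ^ 2 ≤ ∫ x, (‖u x‖ ^ 2 / 2 + 2 * R ^ 2 * ‖pd i u x‖ ^ 2) := by
    calc ∫ x, ‖u x‖ ^ 2 ≤ ‖((∫ x, ‖u x‖ ^ 2 : ℝ) : ℂ)‖ := by
          rw [Complex.norm_real]; exact le_abs_self _
      _ ≤ _ := by
        rw [h3, norm_neg]
        refine norm_integral_le_of_norm_le ((hin.div_const 2).add (hid.const_mul _))
          (.of_forall fun x => ?_)
        by_cases hx : R < ‖x‖
        · rw [hsupp x hx]
          simp only [mul_zero, zero_mul, map_zero, add_zero, norm_zero]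
          positivity
        · have hxi : |x i| ≤ R := by
            rw [← Real.norm_eq_abs]
            exact (PiLp.norm_apply_le x i).trans (not_lt.1 hx)
          refine (norm_add_le _ _).trans ?_
          simp only [norm_mul, Complex.norm_conj, Complex.norm_real, Real.norm_eq_abs]
          have := mul_le_mul_of_nonneg_right hxi
            (mul_nonneg (norm_nonneg (u x)) (norm_nonneg (pd i u x)))
          nlinarith [sq_nonneg (‖u x‖ - 2 * R * ‖pd i u x‖)]
  rw [integral_add (hin.div_const 2) (hid.const_mul _), integral_div, integral_const_mul] at h4
  linarith

lemma lap_expWave_mul (hu : ContDiff ℝ 2 u) (τ : ℝ) (x : R3) :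
    lap (fun y => Complex.exp (τ * ((y 0 : ℝ) : ℂ)) * u y) x +
        (τ : ℂ) ^ 2 * (Complex.exp (τ * ((x 0 : ℝ) : ℂ)) * u x) =
      2 * τ * pd 0 (fun y => Complex.exp (τ * ((y 0 : ℝ) : ℂ)) * u y) x +
        Complex.exp (τ * ((x 0 : ℝ) : ℂ)) * lap u x := by
  set e : R3 → ℂ := fun y => Complex.exp (τ * ((y 0 : ℝ) : ℂ)) with he
  have heC : ContDiff ℝ 2 e := (contDiff_const.mul (contDiff_coord 0)).cexp
  have hcoord : Differentiable ℝ fun x : R3 => ((x 0 : ℝ) : ℂ) :=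
    (contDiff_coord (n := 1) 0).differentiable (by norm_num)
  have hpd : ∀ j, pd j e = fun y => (τ * if j = 0 then 1 else 0) * e y := by
    intro j
    ext y
    have h1 := (((hcoord y).hasFDerivAt.const_mul (τ : ℂ)).cexp).fderiv
    have h2 := pd_coord j 0 y
    rw [pd] at h2
    rw [pd, he, h1]
    simp only [smul_apply, h2, smul_eq_mul]
    ring
  have hlap : lap e x = (τ : ℂ) ^ 2 * e x := by
    have : ∀ j, pd j (pd j e) x =
        (τ * if j = 0 then 1 else 0) * ((τ * if j = 0 then 1 else 0) * e x) := by
      intro j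
      rw [hpd j, pd_const_mul j _ (heC.differentiable (by norm_num) x), hpd j]
    simp only [lap, this, Fin.sum_univ_three]
    simp
    ring
  have h0 : pd 0 (fun y => e y * u y) x = pd 0 e x * u x + e x * pd 0 u x :=
    pd_mul 0 (heC.differentiable (by norm_num) x) (hu.differentiable (by norm_num) x)
  have h1 := lap_mul heC.contDiffAt (hu.contDiffAt (x := x))
  change lap (fun y => e y * u y) x + (τ : ℂ) ^ 2 * (e x * u x) =
    2 * τ * pd 0 (fun y => e y * u y) x + e x * lap u x
  rw [h1, h0, hlap, Fin.sum_univ_three]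
  simp only [hpd]
  simp
  ring

lemma two_mul_integral_norm_sq_pd_eq {w V : R3 → ℂ} {τ : ℝ} (hV : Continuous V)
    (hw : ContDiff ℝ 2 w) (hc : HasCompactSupport w)
    (heq : ∀ x, lap w x + (τ : ℂ) ^ 2 * w x = 2 * τ * pd 0 w x - V x * w x) :
    2 * τ * ∫ x, ‖pd 0 w x‖ ^ 2 = (∫ x, V x * w x * conj (pd 0 w x)).re := by
  have hw1 : ContDiff ℝ 1 w := hw.of_le (by norm_num)
  have hpc := hw1.continuous_pd 0
  have hcp : Continuous fun x => conj (pd 0 w x) := Complex.continuous_conj.comp hpc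
  have hin := integrable_norm_sq hw.continuous hc
  have hidd := integrable_norm_sq hpc (hc.pd 0)
  have heqw : ∀ x, lap w x * conj (pd 0 w x) + (τ : ℂ) ^ 2 * (w x * conj (pd 0 w x)) =
      ((2 * τ * ‖pd 0 w x‖ ^ 2 : ℝ) : ℂ) - V x * w x * conj (pd 0 w x) := by
    intro x
    have h2 : pd 0 w x * conj (pd 0 w x) = ((‖pd 0 w x‖ ^ 2 : ℝ) : ℂ) := by
      rw [Complex.mul_conj, Complex.normSq_eq_norm_sq]
    rw [← mul_assoc, ← add_mul, heq, sub_mul, mul_assoc _ (pd 0 w x), h2]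
    push_cast
    ring
  have hlapc : Continuous (lap w) := by
    unfold lap
    exact continuous_finsetSum _ fun j _ =>
      ((hw.pd (m := 1) (by norm_num) j).continuous_pd j)
  have hi1 : Integrable fun x => lap w x * conj (pd 0 w x) :=
    (hlapc.mul hcp).integrable_of_hasCompactSupport (hasCompactSupport_conj (hc.pd 0)).mul_left
  have hi2 : Integrable fun x => w x * conj (pd 0 w x) :=
    (hw.continuous.mul hcp).integrable_of_hasCompactSupport hc.mul_right
  have hi3 : Integrable fun x => V x * w x * conj (pd 0 w x) :=
    ((hV.mul hw.continuous).mul hcp).integrable_of_hasCompactSupport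
      (hasCompactSupport_conj (hc.pd 0)).mul_left
  have hre := re_integral_lap_mul_conj_pd hw hc 0
  have hre2 := re_integral_mul_conj_pd hw1 hc 0
  have hsum : (∫ x, (lap w x * conj (pd 0 w x) + (τ : ℂ) ^ 2 *
    (w x * conj (pd 0 w x)))).re = 0 := by
    rw [integral_add hi1 (hi2.const_mul _), integral_const_mul, Complex.add_re, hre,
      ← Complex.ofReal_pow, Complex.re_ofReal_mul, hre2, mul_zero, add_zero]
  simp only [heqw] at hsum
  have hi4 : Integrable fun x => ((2 * τ * ‖pd 0 w x‖ ^ 2 : ℝ) : ℂ) :=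
    (hidd.const_mul (2 * τ)).ofReal
  rw [integral_sub hi4 hi3, Complex.sub_re, integral_complex_ofReal,
    Complex.ofReal_re, integral_const_mul] at hsum
  exact sub_eq_zero.1 hsum

lemma eq_zero_of_conjugated_eq {w V : R3 → ℂ} {M R : ℝ} (hV : Continuous V)
    (hM : ∀ x ∈ closedBall (0 : R3) R, ‖V x‖ ≤ M) (hw : ContDiff ℝ 2 w)
    (hws : ∀ x, R < ‖x‖ → w x = 0)
    (heq : ∀ x, lap w x + ((1 + M ^ 2 * R ^ 2 : ℝ) : ℂ) ^ 2 * w x =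
      2 * ((1 + M ^ 2 * R ^ 2 : ℝ) : ℂ) * pd 0 w x - V x * w x) : w = 0 := by
  have hc : HasCompactSupport w := HasCompactSupport.intro (isCompact_closedBall 0 R) fun x hx =>
    hws x (by simpa using hx)
  have hw1 : ContDiff ℝ 1 w := hw.of_le (by norm_num)
  have hpoin := integral_norm_sq_le hw1 hws 0
  have hpc := hw1.continuous_pd 0
  have hsum := two_mul_integral_norm_sq_pd_eq hV hw hc heq
  have hin := integrable_norm_sq hw.continuous hc
  have hidd := integrable_norm_sq hpc (hc.pd 0)
  have hbound : ‖∫ x, V x * w x * conj (pd 0 w x)‖ ≤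
      ∫ x, (‖pd 0 w x‖ ^ 2 + M ^ 2 / 4 * ‖w x‖ ^ 2) := by
    refine norm_integral_le_of_norm_le (hidd.add (hin.const_mul _)) (.of_forall fun x => ?_)
    by_cases hx : R < ‖x‖
    · rw [hws x hx]
      simp only [mul_zero, zero_mul, norm_zero]
      positivity
    · have h1 := hM x (by rw [mem_closedBall_zero_iff]; exact not_lt.1 hx)
      simp only [norm_mul, Complex.norm_conj]
      have := mul_le_mul_of_nonneg_right h1
        (mul_nonneg (norm_nonneg (w x)) (norm_nonneg (pd 0 w x)))
      nlinarith [sq_nonneg (‖pd 0 w x‖ - M / 2 * ‖w x‖)]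
  rw [integral_add hidd (hin.const_mul _), integral_const_mul] at hbound
  have hle := hsum.le.trans ((Complex.re_le_norm _).trans hbound)
  have hnn : 0 ≤ ∫ x, ‖pd 0 w x‖ ^ 2 := integral_nonneg fun x => by positivity
  have hz : ∫ x, ‖pd 0 w x‖ ^ 2 ≤ 0 := by
    generalize ∫ x, ‖pd 0 w x‖ ^ 2 = a at *
    generalize ∫ x, ‖w x‖ ^ 2 = b at *
    have h5 : M ^ 2 / 4 * b ≤ M ^ 2 / 4 * (4 * R ^ 2 * a) :=
      mul_le_mul_of_nonneg_left hpoin (by positivity)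
    have h6 : 0 ≤ (M ^ 2 * R ^ 2) * a := mul_nonneg (by positivity) hnn
    linarith
  have hwz : ∫ x, ‖w x‖ ^ 2 = 0 := by
    refine le_antisymm (hpoin.trans ?_) (integral_nonneg fun x => by positivity)
    rw [le_antisymm hz hnn, mul_zero]
  ext x
  by_contra hne
  have hcont : Continuous fun y => ‖w y‖ ^ 2 := hw.continuous.norm.pow 2
  have hcs : HasCompactSupport fun y => ‖w y‖ ^ 2 :=
    hc.comp_left (g := fun z : ℂ => ‖z‖ ^ 2) (by simp)
  have hne2 : ‖w x‖ ^ 2 ≠ 0 := pow_ne_zero 2 (norm_ne_zero_iff.2 hne)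
  have hpos : 0 < ∫ y, ‖w y‖ ^ 2 :=
    hcont.integral_pos_of_hasCompactSupport_nonneg_nonzero hcs (fun y => sq_nonneg ‖w y‖) hne2
  exact hpos.ne' hwz

lemma eq_zero_of_lap_eq_mul {V : R3 → ℂ} (hV : Continuous V) (hu : ContDiff ℝ 2 u)
    (hc : HasCompactSupport u) (heq : ∀ x, lap u x = -V x * u x) : u = 0 := by
  obtain ⟨R, hR, hsub⟩ := hc.isCompact.isBounded.subset_closedBall_lt 0 0
  have hsupp : ∀ x, R < ‖x‖ → u x = 0 := fun x hx =>
    image_eq_zero_of_notMem_tsupport fun h => by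
      have := hsub h
      rw [mem_closedBall_zero_iff] at this
      linarith
  obtain ⟨M, hM⟩ := (isCompact_closedBall (0 : R3) R).exists_bound_of_continuousOn hV.continuousOn
  have hw : (fun y : R3 =>
      Complex.exp (((1 + M ^ 2 * R ^ 2 : ℝ) : ℂ) * ((y 0 : ℝ) : ℂ)) * u y) = 0 := by
    refine eq_zero_of_conjugated_eq hV hM ((contDiff_const.mul (contDiff_coord 0)).cexp.mul hu)
      (fun x hx => by rw [hsupp x hx, mul_zero]) fun x => ?_
    rw [lap_expWave_mul hu, heq]
    ring
  ext x
  exact (mul_eq_zero.1 (congrFun hw x)).resolve_left (Complex.exp_ne_zero _)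

end Carleman

section Maxwell

open Set Metric Filter

lemma lap_add {u v : R3 → ℂ} {x : R3} (hu : ContDiffAt ℝ 2 u x) (hv : ContDiffAt ℝ 2 v x) :
    lap (fun y => u y + v y) x = lap u x + lap v x := by
  have hd : ∀ {w : R3 → ℂ}, ContDiffAt ℝ 2 w x → ∀ᶠ y in 𝓝 x, DifferentiableAt ℝ w y := fun h =>
    (h.eventually (by simp)).mono fun y hy => hy.differentiableAt (by norm_num)
  have h1 : ∀ j, pd j (pd j fun y => u y + v y) x = pd j (pd j u) x + pd j (pd j v) x := by
    intro j
    have h2 : pd j (fun y => u y + v y) =ᶠ[𝓝 x] fun y => pd j u y + pd j v y := by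
      filter_upwards [hd hu, hd hv] with y hy hy' using pd_add j hy hy'
    rw [pd_congr h2, pd_add j ((hu.pd (m := 1) (by norm_num) j).differentiableAt (by norm_num))
      ((hv.pd (m := 1) (by norm_num) j).differentiableAt (by norm_num))]
  simp only [lap, h1, Finset.sum_add_distrib]

lemma lap_const_mul {u : R3 → ℂ} {x : R3} (c : ℂ) (hu : ContDiffAt ℝ 2 u x) :
    lap (fun y => c * u y) x = c * lap u x := by
  have h := lap_mul (u := fun _ => c) contDiffAt_const hu
  have hc : ∀ j, pd j (fun _ : R3 => c) = fun _ => 0 := fun j => by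
    ext y
    exact pd_const j c
  have hl : lap (fun _ : R3 => c) x = 0 := by simp only [lap, hc, pd_const, Finset.sum_const_zero]
  rw [h, hl]
  simp [hc]

lemma curl_curl {F : R3 → Fin 3 → ℂ} (hF : ∀ i, ContDiff ℝ 2 fun y => F y i) (x : R3)
    (i : Fin 3) : curl (curl F) x i = pd i (vdiv F) x - lap (fun y => F y i) x := by
  have hpd : ∀ i j, DifferentiableAt ℝ (pd j fun y => F y i) x := fun i j =>
    ((hF i).pd (m := 1) (by norm_num) j).differentiable (by norm_num) x
  have hcomm : ∀ l i j, pd i (pd j fun y => F y l) x = pd j (pd i fun y => F y l) x :=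
    fun l i j => pd_comm (hF l).contDiffAt i j
  have hdiv : pd i (vdiv F) x = ∑ j, pd i (pd j fun y => F y j) x :=
    pd_sum Finset.univ i fun j _ => hpd j j
  rw [hdiv]
  fin_cases i <;>
  · simp only [curl, lap, Fin.sum_univ_three]
    simp [pd_sub, hpd]
    rw [hcomm 0, hcomm 1, hcomm 2]
    ring

def planeWave (k : ℝ) (α x : R3) : ℂ :=
  Complex.exp (I * (k : ℂ) * ((∑ j, α j * x j : ℝ) : ℂ))

lemma contDiff_planeWave {n : ℕ∞ω} (k : ℝ) (α : R3) : ContDiff ℝ n (planeWave k α) := by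
  have h : planeWave k α = fun x => Complex.exp (I * k * ∑ j, (α j : ℂ) * ((x j : ℝ) : ℂ)) := by
    ext x
    simp [planeWave]
  rw [h]
  exact (contDiff_const.mul
    (ContDiff.sum fun j _ => contDiff_const.mul (contDiff_coord j))).cexp

lemma pd_planeWave (k : ℝ) (α : R3) (i : Fin 3) :
    pd i (planeWave k α) = fun x => I * k * α i * planeWave k α x := by
  have h : planeWave k α = fun x => Complex.exp (I * k * ∑ j, (α j : ℂ) * ((x j : ℝ) : ℂ)) := by
    ext x
    simp [planeWave]
  have hcoord : ∀ j x, DifferentiableAt ℝ (fun x : R3 => ((x j : ℝ) : ℂ)) x := fun j x =>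
    (contDiff_coord (n := 1) j).differentiable (by norm_num) x
  have hterm : ∀ j x, DifferentiableAt ℝ (fun x : R3 => (α j : ℂ) * ((x j : ℝ) : ℂ)) x :=
    fun j x => (hcoord j x).const_mul _
  ext x
  have hsum : pd i (fun x : R3 => ∑ j, (α j : ℂ) * ((x j : ℝ) : ℂ)) x = α i := by
    rw [pd_sum Finset.univ i fun j _ => hterm j x]
    simp only [pd_const_mul i _ (hcoord _ x), pd_coord]
    simp
  have hd : DifferentiableAt ℝ (fun x : R3 => ∑ j, (α j : ℂ) * ((x j : ℝ) : ℂ)) x :=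
    DifferentiableAt.fun_sum fun j _ => hterm j x
  have h1 := ((hd.hasFDerivAt.const_mul (I * (k : ℂ))).cexp).fderiv
  rw [pd] at hsum
  rw [h, pd, h1]
  simp only [smul_apply, hsum, smul_eq_mul]
  ring

lemma lap_planeWave (k : ℝ) {α : R3} (hα : ‖α‖ = 1) (x : R3) :
    lap (planeWave k α) x = -(k : ℂ) ^ 2 * planeWave k α x := by
  have h : ∀ j, pd j (pd j (planeWave k α)) x =
      -(k : ℂ) ^ 2 * planeWave k α x * ((α j : ℂ) * α j) := fun j => by
    rw [pd_planeWave, pd_const_mul j _ ((contDiff_planeWave (n := 1) k α).differentiable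
      (by norm_num) x), pd_planeWave]
    linear_combination (k : ℂ) ^ 2 * α j ^ 2 * planeWave k α x * Complex.I_sq
  simp only [lap, h]
  rw [← Finset.mul_sum, sum_coord_sq, hα]
  simp

lemma pot_add {u v : R3 → ℂ} (k : ℝ) (hu : Continuous u) (huc : HasCompactSupport u)
    (hv : Continuous v) (hvc : HasCompactSupport v) (x : R3) :
    pot k (fun y => u y + v y) x = pot k u x + pot k v x := by
  simp only [pot, mul_add]
  exact integral_add (integrable_ker_mul k hu huc x) (integrable_ker_mul k hv hvc x)

lemma pot_const_mul (k : ℝ) (c : ℂ) (u : R3 → ℂ) (x : R3) :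
    pot k (fun y => c * u y) x = c * pot k u x := by
  simp only [pot, mul_left_comm _ c]
  exact integral_const_mul c _

lemma pot_sum {ι : Type*} (s : Finset ι) {w : ι → R3 → ℂ} (k : ℝ)
    (hw : ∀ i ∈ s, Continuous (w i)) (hc : ∀ i ∈ s, HasCompactSupport (w i)) (x : R3) :
    pot k (fun y => ∑ i ∈ s, w i y) x = ∑ i ∈ s, pot k (w i) x := by
  simp only [pot, Finset.mul_sum]
  exact integral_finsetSum s fun i hi => integrable_ker_mul k (hw i hi) (hc i hi) x

/-- Uniqueness for the scattering problem `Δψ + (k² + p)ψ = 0` in integral form. -/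
lemma pot_eq_zero_of_eq_mul_pot {k : ℝ} (hk : 0 < k) {p f : R3 → ℂ} (hp : Continuous p)
    (hpim : ∀ x, 0 ≤ (p x).im) (hf : ContDiff ℝ 1 f) (hc : HasCompactSupport f)
    (hfp : ∀ x, f x = p x * pot k f x) : pot k f = 0 := by
  obtain ⟨R, hR, hsub⟩ := hc.isCompact.isBounded.subset_closedBall_lt 0 0
  have hsupp : ∀ x, R < ‖x‖ → f x = 0 := fun x hx =>
    image_eq_zero_of_notMem_tsupport fun h => by
      have := hsub h
      rw [mem_closedBall_zero_iff] at this
      linarith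
  have hψc : HasCompactSupport (pot k f) :=
    hasCompactSupport_pot_of_farField_eq_zero hk.ne' hR hf hsupp fun x hx =>
      farField_zero_eq_zero hk hR hf hc hsupp hfp hpim hx
  refine eq_zero_of_lap_eq_mul (V := fun x => (k : ℂ) ^ 2 + p x) (continuous_const.add hp)
    (contDiff_two_pot k hf hc) hψc fun x => ?_
  rw [lap_pot k hf hc, hfp x]
  ring

lemma grad_eq_zero_of_notMem {D : Set R3} (hD : IsOpen D) {K2 : R3 → ℂ} {c : ℂ}
    (hout : ∀ x, x ∉ D → K2 x = c) (hbd : ∀ x ∈ frontier D, grad K2 x = 0) {x : R3}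
    (hx : x ∉ D) : grad K2 x = 0 := by
  by_cases hcl : x ∈ closure D
  · exact hbd x (by rw [hD.frontier_eq]; exact ⟨hcl, hx⟩)
  · have hev : K2 =ᶠ[𝓝 x] fun _ => c := by
      filter_upwards [isClosed_closure.isOpen_compl.mem_nhds hcl] with y hy
      exact hout y fun h => hy (subset_closure h)
    ext i
    change pd i K2 x = 0
    rw [pd_congr hev, pd_const]

end Maxwell

section IntegralEquation

open Set Metric Filter

variable {k : ℝ} {α : R3} {e : Fin 3 → ℂ} {E P : R3 → Fin 3 → ℂ} {Q : R3 → ℂ}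

lemma contDiff_pd_pot_of_eq (hP : ∀ i, ContDiff ℝ 1 fun y => P y i)
    (hPc : ∀ i, HasCompactSupport fun y => P y i) (hE : ∀ i, ContDiff ℝ 2 fun y => E y i)
    (heq : ∀ x i, E x i = e i * planeWave k α x + pot k (fun y => P y i) x + pd i (pot k Q) x)
    (i : Fin 3) : ContDiff ℝ 2 (pd i (pot k Q)) := by
  have h : pd i (pot k Q) =
      fun x => E x i - (e i * planeWave k α x + pot k (fun y => P y i) x) := by
    ext x
    rw [heq]
    ring
  rw [h]
  exact (hE i).sub ((contDiff_const.mul (contDiff_planeWave k α)).add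
    (contDiff_two_pot k (hP i) (hPc i)))

lemma vdiv_add_eq_pot (heα : ∑ i, e i * α i = 0) (hP : ∀ i, ContDiff ℝ 1 fun y => P y i)
    (hPc : ∀ i, HasCompactSupport fun y => P y i) (hQ : ContDiff ℝ 1 Q) (hQc : HasCompactSupport Q)
    (hE : ∀ i, ContDiff ℝ 2 fun y => E y i)
    (heq : ∀ x i, E x i = e i * planeWave k α x + pot k (fun y => P y i) x + pd i (pot k Q) x)
    (x : R3) : vdiv E x + Q x = pot k (fun y => vdiv P y + -(k : ℂ) ^ 2 * Q y) x := by
  have hpw : Differentiable ℝ (planeWave k α) :=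
    (contDiff_planeWave (n := 1) k α).differentiable (by norm_num)
  have hpot : ∀ i, Differentiable ℝ (pot k fun y => P y i) := fun i =>
    (contDiff_two_pot k (hP i) (hPc i)).differentiable (by norm_num)
  have hgr : ∀ i, Differentiable ℝ (pd i (pot k Q)) := fun i =>
    (contDiff_pd_pot_of_eq hP hPc hE heq i).differentiable (by norm_num)
  have hd : ∀ i, pd i (fun y => E y i) x = I * k * planeWave k α x * (e i * α i) +
      pot k (pd i fun y => P y i) x + pd i (pd i (pot k Q)) x := by
    intro i
    have h1 : (fun y => E y i) =
        fun y => e i * planeWave k α y + pot k (fun z => P z i) y + pd i (pot k Q) y := by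
      ext y
      exact heq y i
    rw [h1, pd_add i (((hpw x).const_mul _).fun_add (hpot i x)) (hgr i x),
      pd_add i ((hpw x).const_mul _) (hpot i x), pd_const_mul i _ (hpw x), pd_planeWave,
      pd_pot_eq_pot_pd k (hP i) (hPc i)]
    ring
  have hdc : ∀ i, Continuous (pd i fun y => P y i) := fun i => (hP i).continuous_pd i
  have hvc : Continuous (vdiv P) := continuous_finsetSum _ fun i _ => hdc i
  have hvs : HasCompactSupport (vdiv P) := by
    have h1 : vdiv P = fun y => pd 0 (fun z => P z 0) y + pd 1 (fun z => P z 1) y +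
        pd 2 (fun z => P z 2) y := by
      ext y
      rw [vdiv, Fin.sum_univ_three]
    rw [h1]
    exact (((hPc 0).pd 0).add ((hPc 1).pd 1)).add ((hPc 2).pd 2)
  have hvP : pot k (vdiv P) x = ∑ i, pot k (pd i fun y => P y i) x :=
    pot_sum Finset.univ k (fun i _ => hdc i) (fun i _ => (hPc i).pd i) x
  have hlap : ∑ i, pd i (pd i (pot k Q)) x = -(k : ℂ) ^ 2 * pot k Q x - Q x := lap_pot k hQ hQc x
  have hQ' : Continuous fun y => -(k : ℂ) ^ 2 * Q y := continuous_const.mul hQ.continuous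
  rw [pot_add k hvc hvs hQ' hQc.mul_left, pot_const_mul, hvP,
    vdiv]
  simp only [hd]
  rw [Finset.sum_add_distrib, Finset.sum_add_distrib, ← Finset.mul_sum, heα, hlap]
  ring

lemma curl_curl_eq_of_vdiv_eq (hα : ‖α‖ = 1) (hP : ∀ i, ContDiff ℝ 1 fun y => P y i)
    (hPc : ∀ i, HasCompactSupport fun y => P y i) (hQ : ContDiff ℝ 1 Q) (hQc : HasCompactSupport Q)
    (hE : ∀ i, ContDiff ℝ 2 fun y => E y i)
    (heq : ∀ x i, E x i = e i * planeWave k α x + pot k (fun y => P y i) x + pd i (pot k Q) x)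
    (hdiv : ∀ x, vdiv E x + Q x = 0) (x : R3) (i : Fin 3) :
    curl (curl E) x i = (k : ℂ) ^ 2 * E x i + P x i := by
  have hpw : ContDiff ℝ 2 (planeWave k α) := contDiff_planeWave k α
  have hpot := contDiff_two_pot k (hP i) (hPc i)
  have hQ2 := contDiff_two_pot k hQ hQc
  have hgr := contDiff_pd_pot_of_eq hP hPc hE heq
  have hdiv' : vdiv E = fun y => (-1 : ℂ) * Q y := by
    ext y
    rw [eq_neg_of_add_eq_zero_left (hdiv y)]
    ring
  have hQd : DifferentiableAt ℝ Q x := hQ.differentiable (by norm_num) x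
  have hE1 : (fun y => E y i) =
      fun y => e i * planeWave k α y + pot k (fun z => P z i) y + pd i (pot k Q) y := by
    ext y
    exact heq y i
  have hlap_gr : lap (pd i (pot k Q)) x = -(k : ℂ) ^ 2 * pd i (pot k Q) x - pd i Q x := by
    have h1 : ∀ j, pd j (pd j (pd i (pot k Q))) x = pd i (pd j (pd j (pot k Q))) x := by
      intro j
      have h2 : pd j (pd i (pot k Q)) = pd i (pd j (pot k Q)) := by
        ext y
        exact pd_comm hQ2.contDiffAt j i
      rw [h2, pd_comm (hgr j).contDiffAt j i]
    have h3 : ∀ j, DifferentiableAt ℝ (pd j (pd j (pot k Q))) x := fun j =>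
      ((hgr j).pd (m := 1) (by norm_num) j).differentiable (by norm_num) x
    have h4 : lap (pot k Q) = fun y => -(k : ℂ) ^ 2 * pot k Q y - Q y := by
      ext y
      exact lap_pot k hQ hQc y
    have h5 : DifferentiableAt ℝ (pot k Q) x := hQ2.differentiable (by norm_num) x
    calc lap (pd i (pot k Q)) x = ∑ j, pd i (pd j (pd j (pot k Q))) x := by
          simp only [lap, h1]
      _ = pd i (lap (pot k Q)) x := (pd_sum Finset.univ i fun j _ => h3 j).symm
      _ = _ := by rw [h4, pd_sub i (h5.const_mul _) hQd, pd_const_mul i _ h5]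
  have hlapE : lap (fun y => E y i) x = e i * lap (planeWave k α) x +
      lap (pot k fun y => P y i) x + lap (pd i (pot k Q)) x := by
    have hc : ContDiff ℝ 2 fun y => e i * planeWave k α y := contDiff_const.mul hpw
    rw [hE1, lap_add (hc.add hpot).contDiffAt (hgr i).contDiffAt,
      lap_add hc.contDiffAt hpot.contDiffAt, lap_const_mul _ hpw.contDiffAt]
  rw [curl_curl hE, hlapE, lap_planeWave k hα, lap_pot k (hP i) (hPc i), hlap_gr, hdiv',
    pd_const_mul i _ hQd, heq]
  ring

end IntegralEquation

theorem claim1_integral_equation_implies_maxwell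
    (k : ℝ) (hk : 0 < k) (D : Set R3) (hD : IsOpen D)
    (hDb : Bornology.IsBounded D) (h0D : (0 : R3) ∈ D)
    (K2 : R3 → ℂ) (hK2 : ContDiff ℝ 2 K2) (hK2ne : ∀ x, K2 x ≠ 0)
    (hK2out : ∀ x, x ∉ D → K2 x = (k : ℂ) ^ 2)
    (hK2im : ∀ x, 0 ≤ (K2 x).im)
    (hK2bd : ∀ x ∈ frontier D, grad K2 x = 0)
    (α : R3) (hα : ‖α‖ = 1) (ℰ : Fin 3 → ℝ) (hαℰ : ∑ i, ℰ i * α i = 0)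
    (E : R3 → Fin 3 → ℂ) (hE : ContDiff ℝ 2 E)
    (hinteq : ∀ x : R3, ∀ i : Fin 3,
      E x i = (ℰ i : ℂ) * Complex.exp (Complex.I * (k : ℂ) * ((∑ j, α j * x j : ℝ) : ℂ))
        + (∫ y in D, g k x y * ((K2 y - (k : ℂ) ^ 2) * E y i))
        + pd i (fun z => ∫ y in D,
            g k z y * dotc (fun j => pd j K2 y / K2 y) (E y)) x) :
    (∀ x, curl (curl E) x = fun i => K2 x * E x i) ∧
    (∀ x, dotc (grad K2 x) (E x) + K2 x * vdiv E x = 0) := by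
  have hEi : ∀ i, ContDiff ℝ 2 fun y => E y i := contDiff_pi.1 hE
  have hKd : ∀ j, ContDiff ℝ 1 (pd j K2) := fun j => hK2.pd (by norm_num) j
  have hgrad : ∀ x, x ∉ D → ∀ j, pd j K2 x = 0 := fun x hx j =>
    congrFun (grad_eq_zero_of_notMem hD hK2out hK2bd hx) j
  have hcpt : ∀ f : R3 → ℂ, (∀ x, x ∉ D → f x = 0) → HasCompactSupport f := fun f hf =>
    HasCompactSupport.intro hDb.isCompact_closure fun x hx =>
      hf x fun h => hx (subset_closure h)
  have hset : ∀ (f : R3 → ℂ), (∀ x, x ∉ D → f x = 0) → ∀ x,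
      ∫ y in D, g k x y * f y = pot k f x := fun f hf x =>
    setIntegral_eq_integral_of_forall_compl_eq_zero fun y hy => by rw [hf y hy, mul_zero]
  set p : R3 → ℂ := fun y => K2 y - (k : ℂ) ^ 2 with hp
  set P : R3 → Fin 3 → ℂ := fun y i => p y * E y i with hPdef
  set Q : R3 → ℂ := fun y => dotc (fun j => pd j K2 y / K2 y) (E y) with hQdef
  have hp2 : ContDiff ℝ 2 p := hK2.sub contDiff_const
  have hp0 : ∀ x, x ∉ D → p x = 0 := fun x hx => by simp only [hp, hK2out x hx, sub_self]
  have hP0 : ∀ i x, x ∉ D → P x i = 0 := fun i x hx => by simp only [hPdef, hp0 x hx, zero_mul]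
  have hQ0 : ∀ x, x ∉ D → Q x = 0 := fun x hx => by simp [hQdef, dotc, hgrad x hx]
  have hP2 : ∀ i, ContDiff ℝ 2 fun y => P y i := fun i => hp2.mul (hEi i)
  have hP1 : ∀ i, ContDiff ℝ 1 fun y => P y i := fun i => (hP2 i).of_le (by norm_num)
  have hPc : ∀ i, HasCompactSupport fun y => P y i := fun i => hcpt _ (hP0 i)
  have hQ1 : ContDiff ℝ 1 Q := by
    refine ContDiff.sum fun j _ => ContDiff.mul ?_ ((hEi j).of_le (by norm_num))
    simp only [div_eq_mul_inv]
    exact (hKd j).mul ((hK2.of_le (by norm_num)).inv hK2ne)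
  have hQc : HasCompactSupport Q := hcpt _ hQ0
  have heq : ∀ x i, E x i = (ℰ i : ℂ) * planeWave k α x + pot k (fun y => P y i) x +
      pd i (pot k Q) x := by
    intro x i
    have hpotQ : (fun z => ∫ y in D, g k z y * dotc (fun j => pd j K2 y / K2 y) (E y)) =
        pot k Q := funext (hset Q hQ0)
    have hpotP : ∫ y in D, g k x y * ((K2 y - (k : ℂ) ^ 2) * E y i) =
        pot k (fun y => P y i) x := hset _ (hP0 i) x
    rw [hinteq x i, hpotQ, hpotP]
    rfl
  have heα : ∑ i, (ℰ i : ℂ) * α i = 0 := by exact_mod_cast hαℰ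
  have hKQ : ∀ x, dotc (grad K2 x) (E x) = K2 x * Q x := by
    intro x
    simp only [dotc, grad, hQdef, Finset.mul_sum]
    refine Finset.sum_congr rfl fun j _ => ?_
    have := hK2ne x
    field_simp
  set f : R3 → ℂ := fun y => vdiv P y + -(k : ℂ) ^ 2 * Q y with hfdef
  have hψ : ∀ x, vdiv E x + Q x = pot k f x :=
    vdiv_add_eq_pot heα hP1 hPc hQ1 hQc hEi heq
  have hvP : ∀ x, vdiv P x = dotc (grad K2 x) (E x) + p x * vdiv E x := by
    intro x
    have hpp : ∀ i, pd i p x = pd i K2 x := fun i => by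
      rw [hp, pd_sub i (hK2.differentiable (by norm_num) x) (differentiableAt_const _), pd_const,
        sub_zero]
    simp only [vdiv, dotc, grad, Finset.mul_sum, ← Finset.sum_add_distrib]
    refine Finset.sum_congr rfl fun i _ => ?_
    rw [← hpp i]
    exact pd_mul i (hp2.differentiable (by norm_num) x) ((hEi i).differentiable (by norm_num) x)
  have hfp : ∀ x, f x = p x * pot k f x := by
    intro x
    rw [← hψ x]
    simp only [hfdef, hvP, hKQ, hp]
    ring
  have hf1 : ContDiff ℝ 1 f :=
    (ContDiff.sum fun i _ => (hP2 i).pd (by norm_num) i).add (contDiff_const.mul hQ1)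
  have hpim : ∀ x, 0 ≤ (p x).im := fun x => by
    simp only [hp]
    rw [Complex.sub_im, ← Complex.ofReal_pow, Complex.ofReal_im, sub_zero]
    exact hK2im x
  have hz := pot_eq_zero_of_eq_mul_pot hk hp2.continuous hpim hf1
    (hcpt f fun x hx => by rw [hfp, hp0 x hx, zero_mul]) hfp
  have hdiv : ∀ x, vdiv E x + Q x = 0 := fun x => by rw [hψ, hz, Pi.zero_apply]
  refine ⟨fun x => ?_, fun x => ?_⟩
  · ext i
    rw [curl_curl_eq_of_vdiv_eq hα hP1 hPc hQ1 hQc hEi heq hdiv]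
    simp only [hPdef, hp]
    ring
  · rw [hKQ, ← mul_add, add_comm, hdiv, mul_zero]
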